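/- Let β⃗ be sub-critical, let X ~ ERGM(β⃗) on 𝒢_n, fix an edge labelled 1, and set a_n = 𝔼 X_1. There exists a constant C > 0 such that for all sufficiently large n, |𝔼 ∂_1 H(X) − Ψ_β(a_n)| ≤ C/n, where Ψ_β(p) = Σ_{i=1}^s 2β_i |E_i| p^{|E_i|−1}. -/

import Mathlib

open Finset MeasureTheory Filter
open scoped ENNReal NNReal

namespace ERGM

/-- The set of edges of the complete graph on `Fin n`: non-diagonal unordered pairs. -/
abbrev EdgeSet (n : ℕ) : Type := {p : Sym2 (Fin n) // ¬ p.IsDiag}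

/-- A configuration (graph on `n` vertices): an assignment of `true/false` to each edge. -/
abbrev Config (n : ℕ) : Type := EdgeSet n → Bool

/-- The value of the configuration `x` on the (unordered) pair `{i,j}`; `false` for `i = j`. -/
noncomputable def edgeVal {n : ℕ} (x : Config n) (i j : Fin n) : Bool :=
  if h : (s(i, j) : Sym2 (Fin n)).IsDiag then false else x ⟨s(i, j), h⟩

/-- Real-valued indicator of presence of the edge `{i,j}` in `x`. -/
noncomputable def edgeInd {n : ℕ} (x : Config n) (i j : Fin n) : ℝ :=
  if edgeVal x i j = true then 1 else 0

open scoped Classical in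
/-- Subgraph counting number `N_G(x)`: the number of copies of `G` in `x` (times the
number of automorphisms), i.e. the sum over injective `ψ` of the product of edge
indicators (each edge indicator is idempotent, so counting ordered adjacent pairs
yields the same value as counting edges). -/
noncomputable def NG {n m : ℕ} (G : SimpleGraph (Fin m)) (x : Config n) : ℝ :=
  ∑ ψ : Fin m ↪ Fin n, ∏ a : Fin m, ∏ b : Fin m,
    if G.Adj a b then edgeInd x (ψ a) (ψ b) else 1

/-- The Hamiltonian `H(x) = Σ_i β_i N_{G_i}(x) / n^{|V_i|-2}`. -/
noncomputable def Hamiltonian {n s : ℕ} (V : Fin s → ℕ)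
    (G : ∀ i, SimpleGraph (Fin (V i))) (β : Fin s → ℝ) (x : Config n) : ℝ :=
  ∑ i, β i * NG (G i) x / (n : ℝ) ^ (V i - 2)

/-- The ERGM probability mass function `π(x) ∝ exp(H(x))`. -/
noncomputable def ergmProb {n s : ℕ} (V : Fin s → ℕ)
    (G : ∀ i, SimpleGraph (Fin (V i))) (β : Fin s → ℝ) (x : Config n) : ℝ :=
  Real.exp (Hamiltonian V G β x) / ∑ y : Config n, Real.exp (Hamiltonian V G β y)

/-- Expectation of `f` with respect to the mass function `w`. -/
noncomputable def expect {n : ℕ} (w : Config n → ℝ) (f : Config n → ℝ) : ℝ :=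
  ∑ x : Config n, w x * f x

open scoped Classical in
/-- Probability of the event `A` with respect to the mass function `w`. -/
noncomputable def prob {n : ℕ} (w : Config n → ℝ) (A : Config n → Prop) : ℝ :=
  ∑ x : Config n, if A x then w x else 0

/-- The number of edges `|E(G)|` of a finite graph. -/
noncomputable def numEdges {m : ℕ} (G : SimpleGraph (Fin m)) : ℕ := G.edgeSet.ncard

/-- `Ψ_β(p) = Σ_i 2 β_i |E_i| p^{|E_i|-1}`. -/
noncomputable def Psi {s : ℕ} (V : Fin s → ℕ) (G : ∀ i, SimpleGraph (Fin (V i)))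
    (β : Fin s → ℝ) (p : ℝ) : ℝ :=
  ∑ i, 2 * β i * (numEdges (G i) : ℝ) * p ^ (numEdges (G i) - 1)

/-- `Φ(u) = e^u / (1 + e^u)`. -/
noncomputable def Phi (u : ℝ) : ℝ := Real.exp u / (1 + Real.exp u)

/-- `φ_β(p) = Φ(Ψ_β(p))`. -/
noncomputable def phiFn {s : ℕ} (V : Fin s → ℕ) (G : ∀ i, SimpleGraph (Fin (V i)))
    (β : Fin s → ℝ) : ℝ → ℝ := fun p => Phi (Psi V G β p)

/-- `β` is sub-critical (high temperature) with fixed point `p`: `p` is the unique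
solution of `φ_β(p) = p` and it satisfies `φ_β'(p) < 1`. -/
def Subcritical {s : ℕ} (V : Fin s → ℕ) (G : ∀ i, SimpleGraph (Fin (V i)))
    (β : Fin s → ℝ) (p : ℝ) : Prop :=
  phiFn V G β p = p ∧ (∀ q : ℝ, phiFn V G β q = q → q = p) ∧
    deriv (phiFn V G β) p < 1

/-- The discrete derivative `∂_e H(x) = H(x_{e+}) - H(x_{e-})`. -/
noncomputable def dHam {n s : ℕ} (V : Fin s → ℕ) (G : ∀ i, SimpleGraph (Fin (V i)))
    (β : Fin s → ℝ) (e : EdgeSet n) (x : Config n) : ℝ :=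
  Hamiltonian V G β (Function.update x e true) - Hamiltonian V G β (Function.update x e false)

/-- Real-valued indicator `X_e` of presence of edge `e`. -/
noncomputable def edgeX {n : ℕ} (e : EdgeSet n) (x : Config n) : ℝ := if x e = true then 1 else 0

/-- Two edges of `K_n` share a vertex. -/
def ShareVertex {n : ℕ} (e f : EdgeSet n) : Prop := ∃ v : Fin n, v ∈ e.1 ∧ v ∈ f.1

section Hypercube

variable {E : Type*}

/-- The monomial `∏_{e ∈ A} x_e`. -/
def monomial (A : Finset E) (x : E → Bool) : ℝ := if ∀ e ∈ A, x e = true then 1 else 0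

theorem monomial_mem_Icc (A : Finset E) (x : E → Bool) : monomial A x ∈ Set.Icc (0 : ℝ) 1 := by
  unfold monomial; split_ifs <;> simp

theorem monomial_empty (x : E → Bool) : monomial ∅ x = 1 := by simp [monomial]

/-- A multilinear polynomial, given by a finite family of monomials with coefficients. -/
def poly {J : Type*} [Fintype J] (c : J → ℝ) (A : J → Finset E) (x : E → Bool) : ℝ :=
  ∑ j, c j * monomial (A j) x

theorem poly_mem_Icc {J : Type*} [Fintype J] {c : J → ℝ} (hc : ∀ j, 0 ≤ c j)
    (A : J → Finset E) (x : E → Bool) : poly c A x ∈ Set.Icc 0 (∑ j, c j) :=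
  ⟨sum_nonneg fun j _ => mul_nonneg (hc j) (monomial_mem_Icc _ _).1,
    sum_le_sum fun j _ => mul_le_of_le_one_right (hc j) (monomial_mem_Icc _ _).2⟩

variable [DecidableEq E]

/-- The discrete derivative of `f` in the coordinate `e`. -/
def discDeriv (e : E) (f : (E → Bool) → ℝ) (x : E → Bool) : ℝ :=
  f (Function.update x e true) - f (Function.update x e false)

/-- Averaging of `f` over the coordinate `e`, which takes the value `true` with weight `t`. -/
def resample (e : E) (t : ℝ) (f : (E → Bool) → ℝ) (x : E → Bool) : ℝ :=
  t * f (Function.update x e true) + (1 - t) * f (Function.update x e false)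

/-- Successive averaging over the coordinates in a list. -/
def resampleList (t : ℝ) : List E → ((E → Bool) → ℝ) → (E → Bool) → ℝ
  | [], f => f
  | e :: l, f => resampleList t l (resample e t f)

theorem discDeriv_resample_self (e : E) (t : ℝ) (f : (E → Bool) → ℝ) (x : E → Bool) :
    discDeriv e (resample e t f) x = 0 := by
  simp [discDeriv, resample]

theorem discDeriv_resample_of_ne {e e' : E} (h : e' ≠ e) (t : ℝ) (f : (E → Bool) → ℝ)
    (x : E → Bool) :
    discDeriv e' (resample e t f) x = resample e t (discDeriv e' f) x := by
  simp only [discDeriv, resample, Function.update_comm h]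
  ring

theorem resample_mem_Icc {a b t : ℝ} (ht : t ∈ Set.Icc (0 : ℝ) 1) (e : E)
    {f : (E → Bool) → ℝ} (hf : ∀ x, f x ∈ Set.Icc a b) (x : E → Bool) :
    resample e t f x ∈ Set.Icc a b := by
  have h1 := hf (Function.update x e true)
  have h2 := hf (Function.update x e false)
  have ht' : 0 ≤ 1 - t := sub_nonneg.2 ht.2
  simp only [Set.mem_Icc, resample] at *
  constructor
  · nlinarith [mul_le_mul_of_nonneg_left h1.1 ht.1, mul_le_mul_of_nonneg_left h2.1 ht']
  · nlinarith [mul_le_mul_of_nonneg_left h1.2 ht.1, mul_le_mul_of_nonneg_left h2.2 ht']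

theorem discDeriv_resample_mem_Icc {a b t : ℝ} (ht : t ∈ Set.Icc (0 : ℝ) 1) (e e' : E)
    (h0 : (0 : ℝ) ∈ Set.Icc a b) {f : (E → Bool) → ℝ}
    (hf : ∀ x, discDeriv e' f x ∈ Set.Icc a b) (x : E → Bool) :
    discDeriv e' (resample e t f) x ∈ Set.Icc a b := by
  by_cases h : e' = e
  · subst h; rwa [discDeriv_resample_self]
  · rw [discDeriv_resample_of_ne h]
    exact resample_mem_Icc ht e hf x

theorem resampleList_mono {t : ℝ} (ht : t ∈ Set.Icc (0 : ℝ) 1) (l : List E)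
    {f g : (E → Bool) → ℝ} (h : ∀ x, f x ≤ g x) (x : E → Bool) :
    resampleList t l f x ≤ resampleList t l g x := by
  induction l generalizing f g with
  | nil => exact h x
  | cons e l ih =>
    refine ih fun y => ?_
    exact add_le_add (mul_le_mul_of_nonneg_left (h _) ht.1)
      (mul_le_mul_of_nonneg_left (h _) (sub_nonneg.2 ht.2))

theorem resampleList_sum {J : Type*} [Fintype J] (t : ℝ) (l : List E) (c : J → ℝ)
    (f : J → (E → Bool) → ℝ) (x : E → Bool) :
    resampleList t l (fun y => ∑ j, c j * f j y) x = ∑ j, c j * resampleList t l (f j) x := by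
  induction l generalizing f with
  | nil => rfl
  | cons e l ih =>
    simp only [resampleList]
    rw [← ih]
    congr 1
    funext y
    simp only [resample, mul_sum, ← sum_add_distrib]
    exact sum_congr rfl fun j _ => by ring

theorem resampleList_const_mul (t : ℝ) (l : List E) (c : ℝ) (f : (E → Bool) → ℝ)
    (x : E → Bool) :
    resampleList t l (fun y => c * f y) x = c * resampleList t l f x := by
  simpa using resampleList_sum (J := Unit) t l (fun _ => c) (fun _ => f) x

theorem resample_exp_le {t : ℝ} (ht : t ∈ Set.Icc (0 : ℝ) 1) (e : E) {f : (E → Bool) → ℝ}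
    {r b : ℝ} (hb : ∀ x, |discDeriv e f x| ≤ b) (hr : |r| * b ≤ 1) (x : E → Bool) :
    resample e t (fun y => Real.exp (r * f y)) x ≤
      Real.exp (r ^ 2 * b ^ 2) * Real.exp (r * resample e t f x) := by
  set u := f (Function.update x e true) with hu
  set v := f (Function.update x e false) with hv
  have hd : |u - v| ≤ b := hb x
  have ht' : 0 ≤ 1 - t := sub_nonneg.2 ht.2
  have hb0 : 0 ≤ b := (abs_nonneg _).trans hd
  have hrd : |r * (u - v)| ≤ |r| * b := by
    rw [abs_mul]; exact mul_le_mul_of_nonneg_left hd (abs_nonneg _)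
  have key : ∀ y : ℝ, |y| ≤ |r| * b → Real.exp y ≤ 1 + y + r ^ 2 * b ^ 2 := by
    intro y hy
    have h1 := Real.abs_exp_sub_one_sub_id_le (hy.trans hr)
    have h2 : y ^ 2 ≤ r ^ 2 * b ^ 2 := by
      rw [← sq_abs y, ← sq_abs r, ← mul_pow]
      exact pow_le_pow_left₀ (abs_nonneg _) hy 2
    linarith [(abs_le.1 h1).2]
  have hm : resample e t f x = t * u + (1 - t) * v := rfl
  have e1 : Real.exp (r * u) =
      Real.exp (r * resample e t f x) * Real.exp ((1 - t) * (r * (u - v))) := by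
    rw [← Real.exp_add, hm]; ring_nf
  have e2 : Real.exp (r * v) =
      Real.exp (r * resample e t f x) * Real.exp (-t * (r * (u - v))) := by
    rw [← Real.exp_add, hm]; ring_nf
  have k1 := key ((1 - t) * (r * (u - v))) (by
    rw [abs_mul, abs_of_nonneg ht']
    nlinarith [abs_nonneg (r * (u - v)), ht.1])
  have k2 := key (-t * (r * (u - v))) (by
    rw [abs_mul, abs_neg, abs_of_nonneg ht.1]
    nlinarith [abs_nonneg (r * (u - v)), ht.2])
  have k3 : t * Real.exp ((1 - t) * (r * (u - v))) + (1 - t) * Real.exp (-t * (r * (u - v))) ≤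
      Real.exp (r ^ 2 * b ^ 2) := by
    have := Real.add_one_le_exp (r ^ 2 * b ^ 2)
    nlinarith [mul_le_mul_of_nonneg_left k1 ht.1, mul_le_mul_of_nonneg_left k2 ht']
  calc resample e t (fun y => Real.exp (r * f y)) x
      = t * Real.exp (r * u) + (1 - t) * Real.exp (r * v) := rfl
    _ = (t * Real.exp ((1 - t) * (r * (u - v))) + (1 - t) * Real.exp (-t * (r * (u - v)))) *
        Real.exp (r * resample e t f x) := by rw [e1, e2]; ring
    _ ≤ _ := mul_le_mul_of_nonneg_right k3 (Real.exp_pos _).le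

/-- A bounded-differences exponential moment bound for product Bernoulli measures. -/
theorem resampleList_exp_le {t : ℝ} (ht : t ∈ Set.Icc (0 : ℝ) 1) (l : List E)
    {f : (E → Bool) → ℝ} {r : ℝ} {b : E → ℝ} (hb : ∀ e x, |discDeriv e f x| ≤ b e)
    (hr : ∀ e, |r| * b e ≤ 1) (x : E → Bool) :
    resampleList t l (fun y => Real.exp (r * f y)) x ≤
      Real.exp (r * resampleList t l f x + r ^ 2 * (l.map fun e => b e ^ 2).sum) := by
  induction l generalizing f with
  | nil => simp [resampleList]
  | cons e l ih =>
    simp only [resampleList]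
    have hb' : ∀ e' y, |discDeriv e' (resample e t f) y| ≤ b e' := fun e' y =>
      abs_le.2 (discDeriv_resample_mem_Icc ht e e'
        ⟨neg_nonpos.2 ((abs_nonneg _).trans (hb e' x)), (abs_nonneg _).trans (hb e' x)⟩
        (fun z => abs_le.1 (hb e' z)) y)
    refine (resampleList_mono ht l (resample_exp_le ht e (hb e) (hr e)) x).trans ?_
    rw [resampleList_const_mul]
    refine (mul_le_mul_of_nonneg_left (ih hb') (Real.exp_pos _).le).trans (le_of_eq ?_)
    rw [← Real.exp_add, List.map_cons, List.sum_cons]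
    ring_nf

theorem monomial_update_true (A : Finset E) (e : E) (x : E → Bool) :
    monomial A (Function.update x e true) = monomial (A.erase e) x := by
  unfold monomial
  congr 1
  refine propext (forall_congr' fun f => ?_)
  by_cases h : f = e <;> simp [h]

theorem monomial_update_false (A : Finset E) (e : E) (x : E → Bool) :
    monomial A (Function.update x e false) = if e ∈ A then 0 else monomial A x := by
  split_ifs with he
  · exact if_neg fun h => by simpa using h e he
  · unfold monomial
    congr 1
    refine propext (forall₂_congr fun f hf => ?_)
    rw [Function.update_of_ne (ne_of_mem_of_not_mem hf he)]

theorem discDeriv_monomial (A : Finset E) (e : E) (x : E → Bool) :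
    discDeriv e (monomial A) x = if e ∈ A then monomial (A.erase e) x else 0 := by
  rw [discDeriv, monomial_update_true, monomial_update_false]
  split_ifs with he
  · simp
  · rw [erase_eq_of_notMem he, sub_self]

theorem monomial_insert {A : Finset E} (e : E) (x : E → Bool) :
    monomial (insert e A) x = (if x e = true then 1 else 0) * monomial A x := by
  unfold monomial
  simp only [mem_insert, forall_eq_or_imp]
  by_cases h : x e = true <;> simp [h]

theorem resampleList_monomial (t : ℝ) (l : List E) {A : Finset E} (hA : ∀ e ∈ A, e ∈ l)
    (x : E → Bool) : resampleList t l (monomial A) x = t ^ #A := by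
  induction l generalizing A with
  | nil =>
    obtain rfl : A = ∅ := eq_empty_of_forall_notMem fun e he => by simpa using hA e he
    simp [resampleList, monomial_empty]
  | cons e l ih =>
    simp only [resampleList]
    by_cases he : e ∈ A
    · have : resample e t (monomial A) = fun y => t * monomial (A.erase e) y := by
        funext y; simp [resample, monomial_update_true, monomial_update_false, he]
      rw [this, resampleList_const_mul, ih fun f hf => ?_, ← card_erase_add_one he, pow_succ']
      exact (List.mem_cons.1 (hA f (mem_of_mem_erase hf))).resolve_left (ne_of_mem_erase hf)
    · have : resample e t (monomial A) = monomial A := by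
        funext y
        simp only [resample, monomial_update_true, monomial_update_false, he, if_false,
          erase_eq_of_notMem he]
        ring
      rw [this, ih fun f hf => ?_]
      exact (List.mem_cons.1 (hA f hf)).resolve_left fun h => he (h ▸ hf)

theorem discDeriv_poly {J : Type*} [Fintype J] (c : J → ℝ) (A : J → Finset E) (e : E) :
    discDeriv e (poly c A) =
      poly (fun j => if e ∈ A j then c j else 0) (fun j => (A j).erase e) := by
  funext x
  have : discDeriv e (poly c A) x = ∑ j, c j * discDeriv e (monomial (A j)) x := by
    simp only [discDeriv, poly, ← sum_sub_distrib, mul_sub]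
  rw [this]
  refine sum_congr rfl fun j _ => ?_
  rw [discDeriv_monomial]
  by_cases h : e ∈ A j <;> simp [h]

theorem resampleList_poly [Fintype E] {J : Type*} [Fintype J] (t : ℝ) (c : J → ℝ)
    (A : J → Finset E) (x : E → Bool) :
    resampleList t univ.toList (poly c A) x = ∑ j, c j * t ^ #(A j) := by
  change resampleList t univ.toList (fun y => ∑ j, c j * monomial (A j) y) x = _
  rw [resampleList_sum]
  exact sum_congr rfl fun j _ => by rw [resampleList_monomial _ _ (by simp)]

theorem monotone_of_discDeriv_nonneg [Fintype E] {f : (E → Bool) → ℝ}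
    (hf : ∀ e x, 0 ≤ discDeriv e f x) : Monotone f := by
  intro x y hxy
  have step : ∀ s : Finset E, f x ≤ f (s.piecewise y x) := by
    intro s
    induction s using Finset.induction_on with
    | empty => simp
    | insert e s he ih =>
      refine ih.trans ?_
      rw [piecewise_insert]
      set z := s.piecewise y x
      have hz : z e = x e := by simp [z, he]
      have hd := hf e z
      rcases hx : x e with _ | _
      · rcases hy : y e with _ | _
        · rw [← hx, ← hz, Function.update_eq_self]
        · have : Function.update z e false = z := by rw [← hx, ← hz, Function.update_eq_self]
          rw [discDeriv, this] at hd
          linarith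
      · have hy : y e = true := by
          have := hxy e; rw [hx] at this; exact top_le_iff.1 this
        rw [hy, ← hx, ← hz, Function.update_eq_self]
  simpa using step univ

end Hypercube

theorem Phi_mem_Ioo (u : ℝ) : Phi u ∈ Set.Ioo (0 : ℝ) 1 := by
  have := Real.exp_pos u
  exact ⟨by unfold Phi; positivity, by rw [Phi, div_lt_one (by positivity)]; linarith⟩

theorem Phi_mem_Icc (u : ℝ) : Phi u ∈ Set.Icc (0 : ℝ) 1 :=
  Set.Ioo_subset_Icc_self (Phi_mem_Ioo u)

section Gibbs

variable {E : Type*} [Fintype E] [DecidableEq E]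

/-- Expectation with respect to the Gibbs measure proportional to `exp H`. -/
noncomputable def gibbsE (H f : (E → Bool) → ℝ) : ℝ :=
  ∑ x, Real.exp (H x) / (∑ y, Real.exp (H y)) * f x

/-- Probability with respect to the Gibbs measure proportional to `exp H`. -/
noncomputable def gibbsP (H : (E → Bool) → ℝ) (A : Set (E → Bool)) : ℝ :=
  gibbsE H (A.indicator 1)

/-- Covariance with respect to the Gibbs measure proportional to `exp H`. -/
noncomputable def gibbsCov (H f g : (E → Bool) → ℝ) : ℝ :=
  gibbsE H (fun x => f x * g x) - gibbsE H f * gibbsE H g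

variable (H : (E → Bool) → ℝ)

theorem gibbsE_mono {f g : (E → Bool) → ℝ} (h : ∀ x, f x ≤ g x) : gibbsE H f ≤ gibbsE H g :=
  sum_le_sum fun x _ => mul_le_mul_of_nonneg_left (h x)
    (div_nonneg (Real.exp_pos _).le (sum_nonneg fun _ _ => (Real.exp_pos _).le))

theorem gibbsE_const (c : ℝ) : gibbsE H (fun _ => c) = c := by
  have : 0 < ∑ y, Real.exp (H y) := sum_pos (fun _ _ => Real.exp_pos _) univ_nonempty
  rw [gibbsE, ← sum_mul, ← sum_div, div_self this.ne', one_mul]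

theorem gibbsE_add (f g : (E → Bool) → ℝ) :
    gibbsE H (fun x => f x + g x) = gibbsE H f + gibbsE H g := by
  simp only [gibbsE, mul_add, sum_add_distrib]

theorem gibbsE_sub (f g : (E → Bool) → ℝ) :
    gibbsE H (fun x => f x - g x) = gibbsE H f - gibbsE H g := by
  simp only [gibbsE, mul_sub, sum_sub_distrib]

theorem gibbsE_const_mul (c : ℝ) (f : (E → Bool) → ℝ) :
    gibbsE H (fun x => c * f x) = c * gibbsE H f := by
  simp only [gibbsE, mul_sum]
  exact sum_congr rfl fun x _ => by ring

theorem gibbsE_sum {J : Type*} (s : Finset J) (f : J → (E → Bool) → ℝ) :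
    gibbsE H (fun x => ∑ j ∈ s, f j x) = ∑ j ∈ s, gibbsE H (f j) := by
  simp only [gibbsE, mul_sum]
  exact sum_comm

theorem gibbsE_mem_Icc {a b : ℝ} {f : (E → Bool) → ℝ} (hf : ∀ x, f x ∈ Set.Icc a b) :
    gibbsE H f ∈ Set.Icc a b :=
  ⟨by simpa only [gibbsE_const] using gibbsE_mono H fun x => (hf x).1,
    by simpa only [gibbsE_const] using gibbsE_mono H fun x => (hf x).2⟩

theorem gibbsP_nonneg (A : Set (E → Bool)) : 0 ≤ gibbsP H A :=
  (gibbsE_const H 0).symm.le.trans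
    (gibbsE_mono H fun x => Set.indicator_nonneg (fun _ _ => zero_le_one) x)

theorem gibbsP_le_sum {J : Type*} [Fintype J] {A : Set (E → Bool)} {B : J → Set (E → Bool)}
    (h : A ⊆ ⋃ j, B j) : gibbsP H A ≤ ∑ j, gibbsP H (B j) := by
  unfold gibbsP
  rw [← gibbsE_sum]
  refine gibbsE_mono H fun x => ?_
  have h0 : ∀ j, 0 ≤ (B j).indicator (1 : (E → Bool) → ℝ) x := fun j =>
    Set.indicator_nonneg (fun _ _ => zero_le_one) x
  by_cases hx : x ∈ A
  · obtain ⟨j, hj⟩ := Set.mem_iUnion.1 (h hx)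
    rw [Set.indicator_of_mem hx]
    refine le_trans ?_ (single_le_sum (fun j _ => h0 j) (mem_univ j))
    rw [Set.indicator_of_mem hj]
  · rw [Set.indicator_of_notMem hx]
    exact sum_nonneg fun j _ => h0 j

theorem sum_eq_half_sum_update (e : E) (f : (E → Bool) → ℝ) :
    ∑ x, f x = (∑ x, (f (Function.update x e true) + f (Function.update x e false))) / 2 := by
  have hinv : Function.Involutive fun x : E → Bool => Function.update x e (!x e) := by
    intro x; simp
  have h1 : ∑ x, f (Function.update x e (!x e)) = ∑ x, f x :=
    Equiv.sum_comp hinv.toPerm f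
  have h2 : ∀ x : E → Bool, f (Function.update x e true) + f (Function.update x e false) =
      f x + f (Function.update x e (!x e)) := by
    intro x
    have hx : f x = f (Function.update x e (x e)) := by rw [Function.update_eq_self]
    rcases h : x e with _ | _ <;> rw [hx, h] <;> simp [add_comm]
  simp only [h2, sum_add_distrib, h1]
  ring

theorem gibbsE_resample (e : E) (f : (E → Bool) → ℝ) :
    gibbsE H f = gibbsE H fun x => resample e (Phi (discDeriv e H x)) f x := by
  unfold gibbsE
  rw [sum_eq_half_sum_update e, sum_eq_half_sum_update e (f := fun x => _ * resample _ _ _ x)]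
  congr 1
  refine sum_congr rfl fun x _ => ?_
  simp only [resample, discDeriv, Function.update_idem, Phi, Real.exp_sub]
  have h1 := Real.exp_pos (H (Function.update x e true))
  have h2 := Real.exp_pos (H (Function.update x e false))
  have : 0 < ∑ y, Real.exp (H y) := sum_pos (fun _ _ => Real.exp_pos _) univ_nonempty
  field_simp
  ring

/-- Comparison of a Gibbs measure with the product Bernoulli measure of parameter `t`, for
functions that are monotone (`s = 1`) or antitone (`s = -1`). -/
theorem gibbsE_le_resampleList {s t : ℝ} (hs : s = 1 ∨ s = -1) (ht : t ∈ Set.Icc (0 : ℝ) 1)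
    (l : List E) {f : (E → Bool) → ℝ}
    (hf : ∀ e x, s * discDeriv e f x ∈ Set.Icc (0 : ℝ) 1) :
    gibbsE H f ≤ gibbsE H (resampleList t l f) +
      (l.map fun e => gibbsP H {x | 0 < s * (Phi (discDeriv e H x) - t)}).sum := by
  induction l generalizing f with
  | nil => simp [resampleList]
  | cons e l ih =>
    have hf' : ∀ e' x, s * discDeriv e' (resample e t f) x ∈ Set.Icc (0 : ℝ) 1 := by
      intro e' x
      by_cases h : e' = e
      · subst h; simp [discDeriv_resample_self]
      · rw [discDeriv_resample_of_ne h]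
        have := resample_mem_Icc ht e (f := fun x => s * discDeriv e' f x) (hf e') x
        simp only [resample] at this ⊢
        convert this using 1
        ring
    have h1 : gibbsE H f ≤ gibbsE H (resample e t f) +
        gibbsP H {x | 0 < s * (Phi (discDeriv e H x) - t)} := by
      rw [gibbsE_resample H e f, gibbsP, ← gibbsE_add]
      refine gibbsE_mono H fun x => ?_
      have hd := hf e x
      have hss : s * s = 1 := by rcases hs with rfl | rfl <;> norm_num
      have hP := Phi_mem_Icc (discDeriv e H x)
      have heq : resample e (Phi (discDeriv e H x)) f x = resample e t f x +
          (s * (Phi (discDeriv e H x) - t)) * (s * discDeriv e f x) := by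
        rw [show (s * (Phi (discDeriv e H x) - t)) * (s * discDeriv e f x) =
          (s * s) * ((Phi (discDeriv e H x) - t) * discDeriv e f x) by ring, hss]
        simp only [resample, discDeriv]
        ring
      rw [heq]
      refine add_le_add le_rfl ?_
      by_cases hx : 0 < s * (Phi (discDeriv e H x) - t)
      · simp only [Set.indicator_apply, Set.mem_ofPred_eq, if_pos hx, Pi.one_apply]
        have : s * (Phi (discDeriv e H x) - t) ≤ 1 := by
          rcases hs with rfl | rfl <;> linarith [hP.1, hP.2, ht.1, ht.2]
        exact mul_le_one₀ this hd.1 hd.2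
      · simp only [Set.indicator_apply, Set.mem_ofPred_eq, if_neg hx]
        exact mul_nonpos_of_nonpos_of_nonneg (not_lt.1 hx) hd.1
    have h2 := ih hf'
    simp only [List.map_cons, List.sum_cons, resampleList]
    linarith

theorem gibbsP_deviation_le {s t : ℝ} (hs : s = 1 ∨ s = -1) (ht : t ∈ Set.Icc (0 : ℝ) 1)
    {g : (E → Bool) → ℝ} {b : E → ℝ} (hb : ∀ e x, discDeriv e g x ∈ Set.Icc 0 (b e))
    {r θ η : ℝ} (hr : 0 ≤ r) (hrb : ∀ e, r * b e ≤ 1)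
    (hη : ∀ x, s * (resampleList t univ.toList g x - θ) ≤ -η) :
    gibbsP H {x | 0 < s * (g x - θ)} ≤ Real.exp (-r * η + r ^ 2 * ∑ e, b e ^ 2) +
      ∑ e, gibbsP H {x | 0 < s * (Phi (discDeriv e H x) - t)} := by
  set f : (E → Bool) → ℝ := Set.indicator {x | 0 < s * (g x - θ)} 1 with hfdef
  have hf : ∀ e x, s * discDeriv e f x ∈ Set.Icc (0 : ℝ) 1 := by
    intro e x
    have hd := (hb e x).1
    simp only [discDeriv] at hd ⊢
    rw [hfdef]
    simp only [Set.indicator_apply, Set.mem_ofPred_eq, Pi.one_apply]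
    rcases hs with rfl | rfl <;> split_ifs <;>
      first | (exfalso; linarith) | norm_num
  have h1 := gibbsE_le_resampleList H hs ht univ.toList hf
  rw [sum_map_toList] at h1
  refine h1.trans (add_le_add ?_ le_rfl)
  rw [← gibbsE_const H (Real.exp _)]
  refine gibbsE_mono H fun x => ?_
  have hs1 : |s| = 1 := by rcases hs with rfl | rfl <;> norm_num
  have hss : s ^ 2 = 1 := by rcases hs with rfl | rfl <;> norm_num
  have hle : ∀ y, f y ≤ Real.exp (-(r * s * θ)) * Real.exp (r * s * g y) := by
    intro y
    rw [← Real.exp_add]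
    by_cases hy : 0 < s * (g y - θ)
    · simp only [hfdef, Set.indicator_apply, Set.mem_ofPred_eq, if_pos hy, Pi.one_apply]
      exact Real.one_le_exp (by nlinarith)
    · simp only [hfdef, Set.indicator_apply, Set.mem_ofPred_eq, if_neg hy]
      exact (Real.exp_pos _).le
  refine (resampleList_mono ht _ hle x).trans ?_
  rw [resampleList_const_mul]
  have hexp := resampleList_exp_le ht univ.toList (r := r * s) (b := b)
    (fun e y => by rw [abs_of_nonneg (hb e y).1]; exact (hb e y).2)
    (fun e => by rw [abs_mul, hs1, mul_one, abs_of_nonneg hr]; exact hrb e) x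
  refine (mul_le_mul_of_nonneg_left hexp (Real.exp_pos _).le).trans ?_
  rw [← Real.exp_add, sum_map_toList, mul_pow, hss, mul_one]
  refine Real.exp_le_exp.2 ?_
  nlinarith [mul_le_mul_of_nonneg_left (hη x) hr]

end Gibbs

section Correlation

variable {E : Type*} [Fintype E] [DecidableEq E]

theorem poly_supermodular {J : Type*} [Fintype J] {c : J → ℝ} (hc : ∀ j, 0 ≤ c j)
    (A : J → Finset E) (a b : E → Bool) :
    poly c A a + poly c A b ≤ poly c A (a ⊓ b) + poly c A (a ⊔ b) := by
  simp only [poly, ← sum_add_distrib, ← mul_add]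
  refine sum_le_sum fun j _ => mul_le_mul_of_nonneg_left ?_ (hc j)
  have h1 : (∀ e ∈ A j, a e = true) → (∀ e ∈ A j, (a ⊔ b) e = true) := fun h e he => by
    simp [h e he]
  have h2 : (∀ e ∈ A j, b e = true) → (∀ e ∈ A j, (a ⊔ b) e = true) := fun h e he => by
    simp [h e he]
  have h3 : (∀ e ∈ A j, a e = true) → (∀ e ∈ A j, b e = true) →
      (∀ e ∈ A j, (a ⊓ b) e = true) := fun h h' e he => by
    simp [h e he, h' e he]
  unfold monomial
  split_ifs <;> first | (exfalso; tauto) | norm_num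

variable {H : (E → Bool) → ℝ}

theorem gibbsCov_nonneg (hH : ∀ a b, H a + H b ≤ H (a ⊓ b) + H (a ⊔ b))
    {f g : (E → Bool) → ℝ} (hf : Monotone f) (hg : Monotone g) : 0 ≤ gibbsCov H f g := by
  have hZ : 0 < ∑ y, Real.exp (H y) := sum_pos (fun _ _ => Real.exp_pos _) univ_nonempty
  have key := fkg (f := fun x => f x - f ⊥) (g := fun x => g x - g ⊥)
    (μ := fun x => Real.exp (H x) / ∑ y, Real.exp (H y))
    (fun x => div_nonneg (Real.exp_pos _).le hZ.le) (fun x => sub_nonneg.2 (hf bot_le))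
    (fun x => sub_nonneg.2 (hg bot_le)) (fun _ _ h => sub_le_sub_right (hf h) _)
    (fun _ _ h => sub_le_sub_right (hg h) _) (fun a b => by
      rw [div_mul_div_comm, div_mul_div_comm, ← Real.exp_add, ← Real.exp_add]
      exact div_le_div_of_nonneg_right (Real.exp_le_exp.2 (hH a b)) (mul_pos hZ hZ).le)
  change gibbsE H (fun x => f x - f ⊥) * gibbsE H (fun x => g x - g ⊥) ≤
    _ * gibbsE H (fun x => (f x - f ⊥) * (g x - g ⊥)) at key
  rw [← sum_div, div_self hZ.ne', one_mul, gibbsE_sub, gibbsE_sub, gibbsE_const,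
    gibbsE_const] at key
  have : gibbsE H (fun x => (f x - f ⊥) * (g x - g ⊥)) =
      gibbsE H (fun x => f x * g x) - g ⊥ * gibbsE H f - f ⊥ * gibbsE H g + f ⊥ * g ⊥ := by
    rw [← gibbsE_const_mul, ← gibbsE_const_mul, ← gibbsE_const H (f ⊥ * g ⊥), ← gibbsE_sub,
      ← gibbsE_sub, ← gibbsE_add]
    congr 1
    funext x
    ring
  rw [this] at key
  unfold gibbsCov
  linarith

theorem gibbsCov_sub_right (f g g' : (E → Bool) → ℝ) :
    gibbsCov H f (fun x => g x - g' x) = gibbsCov H f g - gibbsCov H f g' := by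
  simp only [gibbsCov, mul_sub, gibbsE_sub]
  ring

theorem gibbsCov_const_mul_right (c : ℝ) (f g : (E → Bool) → ℝ) :
    gibbsCov H f (fun x => c * g x) = c * gibbsCov H f g := by
  simp only [gibbsCov, mul_left_comm _ c, gibbsE_const_mul]
  ring

theorem gibbsCov_sum_right {J : Type*} (s : Finset J) (f : (E → Bool) → ℝ)
    (g : J → (E → Bool) → ℝ) :
    gibbsCov H f (fun x => ∑ j ∈ s, g j x) = ∑ j ∈ s, gibbsCov H f (g j) := by
  simp only [gibbsCov, mul_sum, gibbsE_sum, sum_sub_distrib]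

theorem gibbsCov_comm (f g : (E → Bool) → ℝ) : gibbsCov H f g = gibbsCov H g f := by
  simp only [gibbsCov, mul_comm]

theorem gibbsCov_le_of_monotone_sub (hH : ∀ a b, H a + H b ≤ H (a ⊓ b) + H (a ⊔ b))
    {f g g' : (E → Bool) → ℝ} (hf : Monotone f) (hg : Monotone fun x => g' x - g x) :
    gibbsCov H f g ≤ gibbsCov H f g' := by
  have := gibbsCov_nonneg hH hf hg
  rw [gibbsCov_sub_right] at this
  linarith

omit [Fintype E] [DecidableEq E] in
theorem monomial_monotone (A : Finset E) : Monotone (monomial A) := by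
  intro x y h
  have : (∀ e ∈ A, x e = true) → ∀ e ∈ A, y e = true := fun hx e he =>
    top_le_iff.1 ((hx e he).symm.le.trans (h e))
  unfold monomial
  split_ifs <;> first | (exfalso; tauto) | norm_num

/-- Under positive association, near-vanishing pair covariances control all moments. -/
theorem abs_gibbsE_monomial_sub_pow_le (hH : ∀ a b, H a + H b ≤ H (a ⊓ b) + H (a ⊔ b))
    {a δ : ℝ} (hδ0 : 0 ≤ δ) (ha : ∀ e, gibbsE H (monomial {e}) = a)
    (hδ : ∀ e f, e ≠ f → gibbsCov H (monomial {e}) (monomial {f}) ≤ δ) (B : Finset E) :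
    |gibbsE H (monomial B) - a ^ #B| ≤ (#B : ℝ) ^ 2 * δ := by
  induction B using Finset.induction_on with
  | empty =>
    have : (monomial ∅ : (E → Bool) → ℝ) = fun _ => 1 := funext monomial_empty
    simp [this, gibbsE_const]
  | insert e B he ih =>
    have ha01 : a ∈ Set.Icc (0 : ℝ) 1 := ha e ▸ gibbsE_mem_Icc H (monomial_mem_Icc _)
    have h0 := gibbsCov_nonneg hH (monomial_monotone {e}) (monomial_monotone B)
    have h1 : gibbsCov H (monomial {e}) (monomial B) ≤ #B * δ := by
      calc gibbsCov H (monomial {e}) (monomial B)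
          ≤ gibbsCov H (monomial {e}) (fun x => ∑ f ∈ B, monomial {f} x) := by
            refine gibbsCov_le_of_monotone_sub hH (monomial_monotone {e})
              (monotone_of_discDeriv_nonneg fun f x => ?_)
            have : discDeriv f (fun x => ∑ f ∈ B, monomial {f} x - monomial B x) x =
                ∑ g ∈ B, discDeriv f (monomial {g}) x - discDeriv f (monomial B) x := by
              simp only [discDeriv, sum_sub_distrib]
              ring
            rw [this]
            simp only [discDeriv_monomial, mem_singleton, sum_ite_eq]
            split_ifs with hf
            · have : monomial (({f} : Finset E).erase f) x = 1 := by simp [monomial]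
              rw [this]
              linarith [(monomial_mem_Icc (B.erase f) x).2]
            · simp
        _ = ∑ f ∈ B, gibbsCov H (monomial {e}) (monomial {f}) := gibbsCov_sum_right _ _ _
        _ ≤ ∑ _f ∈ B, δ := sum_le_sum fun f hf => hδ e f fun h => he (h ▸ hf)
        _ = #B * δ := by simp
    have h2 : gibbsE H (monomial (insert e B)) =
        gibbsCov H (monomial {e}) (monomial B) + a * gibbsE H (monomial B) := by
      have : (monomial (insert e B) : (E → Bool) → ℝ) =
          fun x => monomial {e} x * monomial B x := by
        funext x
        rw [monomial_insert]
        congr 1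
        simp [monomial]
      rw [this, gibbsCov, ha]
      ring
    rw [card_insert_of_notMem he, h2, pow_succ', add_sub_assoc, ← mul_sub]
    have hn : (0 : ℝ) ≤ #B := by positivity
    have h3 : |a * (gibbsE H (monomial B) - a ^ #B)| ≤ (#B : ℝ) ^ 2 * δ := by
      rw [abs_mul, abs_of_nonneg ha01.1]
      exact (mul_le_of_le_one_left (abs_nonneg _) ha01.2).trans ih
    refine (abs_add_le _ _).trans ?_
    rw [abs_of_nonneg h0]
    push_cast
    nlinarith

/-- The number of `true` coordinates. -/
def coordSum (x : E → Bool) : ℝ := ∑ e, monomial {e} x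

omit [DecidableEq E] in
theorem coordSum_mem_Icc (x : E → Bool) : coordSum x ∈ Set.Icc (0 : ℝ) (Fintype.card E) :=
  ⟨sum_nonneg fun e _ => (monomial_mem_Icc _ _).1,
    (sum_le_sum fun e _ => (monomial_mem_Icc {e} x).2).trans (by simp)⟩

theorem discDeriv_coordSum (e : E) (x : E → Bool) : discDeriv e coordSum x = 1 := by
  have : discDeriv e coordSum x = ∑ g : E, discDeriv e (monomial {g}) x := by
    simp only [discDeriv, coordSum, sum_sub_distrib]
  rw [this]
  simp [discDeriv_monomial, monomial]

omit [Fintype E] in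
theorem discDeriv_update (e : E) (f : (E → Bool) → ℝ) (x : E → Bool) (b : Bool) :
    discDeriv e f (Function.update x e b) = discDeriv e f x := by
  simp [discDeriv]

theorem gibbsE_mul_sub_Phi (H f : (E → Bool) → ℝ) (e : E) :
    gibbsE H (fun x => f x * (monomial {e} x - Phi (discDeriv e H x))) =
      gibbsE H fun x => Phi (discDeriv e H x) * (1 - Phi (discDeriv e H x)) *
        discDeriv e f x := by
  rw [gibbsE_resample H e]
  congr 1
  funext x
  have h1 : monomial {e} (Function.update x e true) = 1 := by simp [monomial]
  have h2 : monomial {e} (Function.update x e false) = 0 := by simp [monomial]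
  simp only [resample, discDeriv_update, h1, h2]
  simp only [discDeriv]
  ring

theorem gibbsCov_coordSum_le (H : (E → Bool) → ℝ) :
    gibbsCov H coordSum coordSum ≤
      Fintype.card E + gibbsCov H coordSum fun x => ∑ e, Phi (discDeriv e H x) := by
  have h1 : ∀ e : E, gibbsCov H coordSum (monomial {e}) ≤
      1 + gibbsCov H coordSum (fun x => Phi (discDeriv e H x)) := by
    intro e
    have k1 := gibbsE_mul_sub_Phi H (fun _ => 1) e
    have k2 := gibbsE_mul_sub_Phi H coordSum e
    have k3 : gibbsE H (fun x => Phi (discDeriv e H x) * (1 - Phi (discDeriv e H x)) *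
        discDeriv e coordSum x) ≤ 1 := by
      refine (gibbsE_mono H (g := fun _ => 1) fun x => ?_).trans (gibbsE_const H 1).le
      have := Phi_mem_Icc (discDeriv e H x)
      rw [discDeriv_coordSum]
      nlinarith [this.1, this.2]
    have k4 : ∀ x, discDeriv e (fun _ => (1 : ℝ)) x = 0 := fun x => by simp [discDeriv]
    simp only [one_mul, k4, mul_zero, gibbsE_const, gibbsE_sub] at k1
    simp only [mul_sub, gibbsE_sub] at k2
    unfold gibbsCov
    rw [sub_eq_zero.1 k1]
    simp only [mul_sub] at k3
    linarith
  have h2 : gibbsCov H coordSum coordSum = ∑ e, gibbsCov H coordSum (monomial {e}) :=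
    gibbsCov_sum_right univ coordSum fun e => monomial {e}
  rw [h2, gibbsCov_sum_right]
  refine (sum_le_sum fun e _ => h1 e).trans (le_of_eq ?_)
  rw [sum_add_distrib]
  simp

end Correlation

section Variance

variable {E : Type*} [Fintype E] [DecidableEq E]

theorem Phi_strictMono : StrictMono Phi := by
  intro a b h
  have ha := Real.exp_pos a
  have hb := Real.exp_pos b
  have := Real.exp_lt_exp.2 h
  rw [Phi, Phi, div_lt_div_iff₀ (by positivity) (by positivity)]
  nlinarith

/-- The sum of all discrete derivatives of `H`. -/
def derivSum (H : (E → Bool) → ℝ) (x : E → Bool) : ℝ := ∑ e, discDeriv e H x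

/-- The largest value of `F` on configurations below `x` at which all discrete derivatives of `T`
are at most `d`. -/
noncomputable def cappedSup (F T : (E → Bool) → ℝ) (d : ℝ) (x : E → Bool) : ℝ :=
  open scoped Classical in
  (univ.filter fun y => y ≤ x ∧ (y = ⊥ ∨ ∀ e, discDeriv e T y ≤ d)).sup' ⟨⊥, by simp⟩ F

theorem le_cappedSup {F T : (E → Bool) → ℝ} {d : ℝ} {x y : E → Bool} (hyx : y ≤ x)
    (hy : y = ⊥ ∨ ∀ e, discDeriv e T y ≤ d) : F y ≤ cappedSup F T d x := by
  classical
  exact le_sup' (f := F) (by simpa using ⟨hyx, hy⟩)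

theorem exists_eq_cappedSup (F T : (E → Bool) → ℝ) (d : ℝ) (x : E → Bool) :
    ∃ y, y ≤ x ∧ (y = ⊥ ∨ ∀ e, discDeriv e T y ≤ d) ∧ cappedSup F T d x = F y := by
  classical
  obtain ⟨y, hy, h⟩ := exists_mem_eq_sup'
    (s := univ.filter fun y => y ≤ x ∧ (y = ⊥ ∨ ∀ e, discDeriv e T y ≤ d)) ⟨⊥, by simp⟩ F
  exact ⟨y, (mem_filter.1 hy).2.1, (mem_filter.1 hy).2.2, by
    unfold cappedSup; convert h⟩

theorem cappedSup_eq_self {F T : (E → Bool) → ℝ} (hF : Monotone F) {d : ℝ} {x : E → Bool}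
    (hx : ∀ e, discDeriv e T x ≤ d) : cappedSup F T d x = F x := by
  obtain ⟨y, hy, hy', he⟩ := exists_eq_cappedSup F T d x
  exact le_antisymm (he ▸ hF hy) (le_cappedSup le_rfl (Or.inr hx))

theorem discDeriv_cappedSup_le {F T : (E → Bool) → ℝ} (hT : ∀ e, Monotone (discDeriv e T))
    {K d : ℝ} (hK : 0 ≤ K) (hd : 0 ≤ d)
    (hFT : ∀ e x, discDeriv e F x ≤ K * discDeriv e T x) (e : E) (x : E → Bool) :
    discDeriv e (cappedSup F T d) x ≤ K * d := by
  obtain ⟨y, hy, hy', he⟩ := exists_eq_cappedSup F T d (Function.update x e true)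
  have hle : Function.update y e false ≤ y := by
    intro g
    by_cases h : g = e
    · subst h; simp
    · simp [h]
  have hle' : Function.update y e false ≤ Function.update x e false := by
    intro g
    by_cases h : g = e
    · subst h; simp
    · simpa [h] using hy g
  have h1 : F (Function.update y e false) ≤ cappedSup F T d (Function.update x e false) := by
    refine le_cappedSup hle' (hy'.imp (fun h => ?_) fun h g => (hT g hle).trans (h g))
    exact le_bot_iff.1 (h ▸ hle)
  have h2 : F y ≤ F (Function.update y e false) + K * d := by
    rcases h : y e with _ | _
    · rw [← h, Function.update_eq_self]
      linarith [mul_nonneg hK hd]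
    · have hyt : Function.update y e true = y := by rw [← h, Function.update_eq_self]
      have hbot : y ≠ ⊥ := fun hb => by simp [hb] at h
      have h3 := hFT e y
      have h4 := mul_le_mul_of_nonneg_left ((hy'.resolve_left hbot) e) hK
      simp only [discDeriv, hyt] at h3 h4
      linarith
  rw [discDeriv, he]
  linarith

theorem gibbsCov_coordSum_self_le {H : (E → Bool) → ℝ}
    (hH : ∀ a b, H a + H b ≤ H (a ⊓ b) + H (a ⊔ b))
    (hH' : ∀ e, Monotone (discDeriv e H)) (hT : ∀ e, Monotone (discDeriv e (derivSum H)))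
    {K d a b : ℝ} (hK : 0 ≤ K) (hd : 0 ≤ d) (hab : a ≤ b)
    (hPhi : ∀ u ∈ Set.Icc a b, ∀ v ∈ Set.Icc a b, u ≤ v → Phi v - Phi u ≤ K * (v - u)) :
    (1 - K * d) * gibbsCov H coordSum coordSum ≤ Fintype.card E + (Fintype.card E : ℝ) ^ 2 *
      gibbsP H {x | ¬ ∀ e, discDeriv e H x ∈ Set.Icc a b ∧
        discDeriv e (derivSum H) x ≤ d} := by
  set c : ℝ → ℝ := fun u => max a (min u b) with hc
  have hcmem : ∀ u, c u ∈ Set.Icc a b := fun u =>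
    ⟨le_max_left _ _, max_le hab (min_le_right _ _)⟩
  have hcmono : Monotone c := fun u v h => max_le_max le_rfl (min_le_min h le_rfl)
  have hcid : ∀ u ∈ Set.Icc a b, c u = u := fun u hu => by
    simp [hc, min_eq_left hu.2, max_eq_right hu.1]
  have hclip : ∀ u v, u ≤ v → c v - c u ≤ v - u := by
    intro u v h
    simp only [hc]
    rcases max_cases a (min u b) with h1 | h1 <;> rcases max_cases a (min v b) with h2 | h2 <;>
      rcases min_cases u b with h3 | h3 <;> rcases min_cases v b with h4 | h4 <;> linarith
  set F : (E → Bool) → ℝ := fun x => ∑ e, Phi (c (discDeriv e H x)) with hF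
  have hFmono : Monotone F := fun x y h => sum_le_sum fun e _ =>
    Phi_strictMono.monotone (hcmono (hH' e h))
  have hFT : ∀ e x, discDeriv e F x ≤ K * discDeriv e (derivSum H) x := by
    intro e x
    have hle : Function.update x e false ≤ Function.update x e true := by
      intro g
      by_cases h : g = e
      · subst h; simp
      · simp [h]
    simp only [discDeriv, hF, derivSum, ← sum_sub_distrib, mul_sum]
    refine sum_le_sum fun g _ => ?_
    have h := hH' g hle
    exact (hPhi _ (hcmem _) _ (hcmem _) (hcmono h)).trans
      (mul_le_mul_of_nonneg_left (hclip _ _ h) hK)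
  set F' := cappedSup F (derivSum H) d
  set Q : (E → Bool) → ℝ := fun x => ∑ e, Phi (discDeriv e H x) with hQ
  set B : Set (E → Bool) := {x | ¬ ∀ e, discDeriv e H x ∈ Set.Icc a b ∧
        discDeriv e (derivSum H) x ≤ d} with hB
  have hFmem : ∀ x, F x ∈ Set.Icc (0 : ℝ) (Fintype.card E) := fun x =>
    ⟨sum_nonneg fun e _ => (Phi_mem_Icc _).1,
      (sum_le_sum fun e _ => (Phi_mem_Icc _).2).trans (by simp)⟩
  have hQmem : ∀ x, Q x ∈ Set.Icc (0 : ℝ) (Fintype.card E) := fun x =>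
    ⟨sum_nonneg fun e _ => (Phi_mem_Icc _).1,
      (sum_le_sum fun e _ => (Phi_mem_Icc _).2).trans (by simp)⟩
  have hF'mem : ∀ x, F' x ∈ Set.Icc (0 : ℝ) (Fintype.card E) := fun x => by
    obtain ⟨y, -, -, he⟩ := exists_eq_cappedSup F (derivSum H) d x
    rw [show F' x = F y from he]; exact hFmem y
  have hQF' : ∀ x, |Q x - F' x| ≤ Fintype.card E * B.indicator 1 x := by
    intro x
    by_cases hx : x ∈ B
    · rw [Set.indicator_of_mem hx, Pi.one_apply, mul_one, abs_le]
      constructor <;> linarith [(hQmem x).1, (hQmem x).2, (hF'mem x).1, (hF'mem x).2]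
    · have hx' : ∀ e, discDeriv e H x ∈ Set.Icc a b ∧ discDeriv e (derivSum H) x ≤ d :=
        not_not.1 hx
      have h1 : F' x = F x := cappedSup_eq_self hFmono fun e => (hx' e).2
      have h2 : F x = Q x := sum_congr rfl fun e _ => by rw [hcid _ (hx' e).1]
      rw [Set.indicator_of_notMem hx, h1, h2]
      simp
  have h1 : gibbsCov H coordSum F' ≤ K * d * gibbsCov H coordSum coordSum := by
    rw [← gibbsCov_const_mul_right]
    have hSmono : Monotone (coordSum : (E → Bool) → ℝ) :=
      monotone_of_discDeriv_nonneg fun e x => by rw [discDeriv_coordSum]; exact zero_le_one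
    refine gibbsCov_le_of_monotone_sub hH hSmono (monotone_of_discDeriv_nonneg fun e x => ?_)
    have hd' := discDeriv_cappedSup_le hT hK hd hFT e x
    have hs := discDeriv_coordSum e x
    simp only [discDeriv] at hd' hs ⊢
    change F' _ - F' _ ≤ K * d at hd'
    have h : K * d * coordSum (Function.update x e true) -
        K * d * coordSum (Function.update x e false) = K * d := by rw [← mul_sub, hs, mul_one]
    linarith
  have h2 : gibbsCov H coordSum Q - gibbsCov H coordSum F' ≤
      (Fintype.card E : ℝ) ^ 2 * gibbsP H B := by
    rw [← gibbsCov_sub_right, gibbsCov, gibbsP, ← gibbsE_const_mul, ← gibbsE_const_mul,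
      ← gibbsE_sub]
    refine gibbsE_mono H fun x => ?_
    have hE := gibbsE_mem_Icc H (coordSum_mem_Icc (E := E))
    have hS := coordSum_mem_Icc x
    have : |coordSum x - gibbsE H coordSum| ≤ Fintype.card E :=
      abs_le.2 ⟨by linarith [hE.2, hS.1], by linarith [hE.1, hS.2]⟩
    calc coordSum x * (Q x - F' x) - gibbsE H coordSum * (Q x - F' x)
        = (coordSum x - gibbsE H coordSum) * (Q x - F' x) := by ring
      _ ≤ |coordSum x - gibbsE H coordSum| * |Q x - F' x| := by
        rw [← abs_mul]; exact le_abs_self _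
      _ ≤ Fintype.card E * (Fintype.card E * B.indicator 1 x) :=
        mul_le_mul this (hQF' x) (abs_nonneg _) (Nat.cast_nonneg _)
      _ = _ := by ring
  have h3 := gibbsCov_coordSum_le H
  linarith

end Variance

section PolynomialDerivatives

variable {E J : Type*} [DecidableEq E] [Fintype J]

omit [DecidableEq E] in
theorem poly_monotone {c : J → ℝ} (hc : ∀ j, 0 ≤ c j) (A : J → Finset E) :
    Monotone (poly c A) := fun _ _ h =>
  sum_le_sum fun j _ => mul_le_mul_of_nonneg_left (monomial_monotone (A j) h) (hc j)

/-- The total coefficient of the monomials of `poly c A` containing both `e` and `f`. -/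
def pairWeight (c : J → ℝ) (A : J → Finset E) (e f : E) : ℝ :=
  ∑ j, if e ∈ A j ∧ f ∈ A j then c j else 0

theorem pairWeight_nonneg {c : J → ℝ} (hc : ∀ j, 0 ≤ c j) (A : J → Finset E) (e f : E) :
    0 ≤ pairWeight c A e f :=
  sum_nonneg fun j _ => by split_ifs <;> simp [hc j]

theorem sum_pairWeight [Fintype E] (c : J → ℝ) (A : J → Finset E) (e : E) :
    ∑ f, pairWeight c A e f = ∑ j, if e ∈ A j then c j * #(A j) else 0 := by
  unfold pairWeight
  rw [sum_comm]
  refine sum_congr rfl fun j _ => ?_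
  by_cases h : e ∈ A j
  · simp [h, mul_comm]
  · simp [h]

theorem discDeriv_discDeriv_poly_mem_Icc {c : J → ℝ} (hc : ∀ j, 0 ≤ c j) (A : J → Finset E)
    (e f : E) (x : E → Bool) :
    discDeriv f (discDeriv e (poly c A)) x ∈
      Set.Icc 0 (if f = e then 0 else pairWeight c A e f) := by
  rw [discDeriv_poly, discDeriv_poly]
  have h := poly_mem_Icc (c := fun j => if f ∈ (A j).erase e then if e ∈ A j then c j else 0 else 0)
    (fun j => by split_ifs <;> simp [hc j]) (fun j => ((A j).erase e).erase f) x
  refine ⟨h.1, h.2.trans ?_⟩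
  split_ifs with hfe
  · simp [hfe]
  · refine sum_le_sum fun j _ => le_of_eq ?_
    by_cases h1 : e ∈ A j <;> by_cases h2 : f ∈ A j <;> simp [h1, h2, hfe]

theorem monotone_discDeriv_poly {c : J → ℝ} (hc : ∀ j, 0 ≤ c j) (A : J → Finset E) (e : E) :
    Monotone (discDeriv e (poly c A)) := by
  rw [discDeriv_poly]
  exact poly_monotone (fun j => by split_ifs <;> simp [hc j]) _

variable [Fintype E]

theorem resampleList_discDeriv_poly (t : ℝ) (c : J → ℝ) (A : J → Finset E) (e : E)
    (x : E → Bool) :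
    resampleList t univ.toList (discDeriv e (poly c A)) x =
      ∑ j, if e ∈ A j then c j * t ^ (#(A j) - 1) else 0 := by
  rw [discDeriv_poly, resampleList_poly]
  refine sum_congr rfl fun j _ => ?_
  split_ifs with h
  · rw [card_erase_of_mem h]
  · simp

theorem derivSum_poly (c : J → ℝ) (A : J → Finset E) :
    derivSum (poly c A) = poly (fun q : E × J => if q.1 ∈ A q.2 then c q.2 else 0)
      (fun q => (A q.2).erase q.1) := by
  funext x
  simp only [derivSum, discDeriv_poly, poly, Fintype.sum_prod_type]

theorem pairWeight_derivSum_le {c : J → ℝ} (hc : ∀ j, 0 ≤ c j) (A : J → Finset E) {r : ℕ}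
    (hr : ∀ j, #(A j) ≤ r) (e f : E) :
    pairWeight (fun q : E × J => if q.1 ∈ A q.2 then c q.2 else 0)
      (fun q => (A q.2).erase q.1) e f ≤ r * pairWeight c A e f := by
  simp only [pairWeight, Fintype.sum_prod_type]
  rw [sum_comm, mul_sum]
  refine sum_le_sum fun j _ => ?_
  split_ifs with h
  · calc _ ≤ ∑ g : E, if g ∈ A j then c j else 0 := sum_le_sum fun g _ => by
          have := hc j
          split_ifs <;> simp_all
      _ = #(A j) * c j := by simp
      _ ≤ r * c j := by
        have := hr j
        gcongr
        exact hc j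
  · rw [mul_zero]
    refine (sum_eq_zero fun g _ => if_neg fun h' => h ?_).le
    exact ⟨mem_of_mem_erase h'.1, mem_of_mem_erase h'.2⟩

theorem resampleList_discDeriv_derivSum_poly (t : ℝ) (c : J → ℝ) (A : J → Finset E) (e : E)
    (x : E → Bool) :
    resampleList t univ.toList (discDeriv e (derivSum (poly c A))) x =
      ∑ j, if e ∈ A j then c j * ((#(A j) - 1 : ℕ) * t ^ (#(A j) - 2)) else 0 := by
  rw [derivSum_poly, resampleList_discDeriv_poly, Fintype.sum_prod_type, sum_comm]
  refine sum_congr rfl fun j _ => ?_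
  split_ifs with h
  · have : ∀ g : E, (if e ∈ (A j).erase g then (if g ∈ A j then c j else 0) *
        t ^ (#((A j).erase g) - 1) else 0) =
        if g ∈ (A j).erase e then c j * t ^ (#(A j) - 2) else 0 := by
      intro g
      by_cases h1 : g ∈ A j <;> by_cases h2 : g = e <;>
        simp [h, h1, h2, Ne.symm, Nat.sub_sub]
    simp only [this, sum_ite_mem, univ_inter, sum_const, card_erase_of_mem h, nsmul_eq_mul]
    ring
  · exact sum_eq_zero fun g _ => if_neg fun h' => h (mem_of_mem_erase h')

end PolynomialDerivatives

section Symmetry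

variable {E J : Type*} [Fintype J] {c : J → ℝ} {A : J → Finset E} {τ : E ≃ E} {ρ : J ≃ J}

theorem poly_comp_equiv (hc : ∀ j, c (ρ j) = c j) (hA : ∀ j e, τ e ∈ A (ρ j) ↔ e ∈ A j)
    (x : E → Bool) : poly c A (x ∘ τ) = poly c A x := by
  unfold poly
  symm
  rw [← Equiv.sum_comp ρ]
  refine (sum_congr rfl fun j _ => ?_)
  rw [hc]
  congr 1
  unfold monomial
  congr 1
  refine propext (Equiv.forall_congr τ fun {e} => ?_).symm
  rw [hA]; rfl

theorem pairWeight_equiv [DecidableEq E] (hc : ∀ j, c (ρ j) = c j)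
    (hA : ∀ j e, τ e ∈ A (ρ j) ↔ e ∈ A j) (e f : E) :
    pairWeight c A (τ e) (τ f) = pairWeight c A e f := by
  unfold pairWeight
  rw [← Equiv.sum_comp ρ]
  simp only [hc, hA]

variable [Fintype E] [DecidableEq E] {H : (E → Bool) → ℝ}

theorem gibbsE_comp_equiv (hH : ∀ x : E → Bool, H (x ∘ τ) = H x) (f : (E → Bool) → ℝ) :
    gibbsE H (fun x => f (x ∘ τ)) = gibbsE H f := by
  unfold gibbsE
  rw [← Equiv.sum_comp (Equiv.arrowCongr τ.symm (Equiv.refl Bool))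
    (fun x => Real.exp (H x) / (∑ y, Real.exp (H y)) * f x)]
  refine sum_congr rfl fun x _ => ?_
  change _ = Real.exp (H (x ∘ τ)) / _ * f (x ∘ τ)
  rw [hH]

omit [Fintype E] [DecidableEq E] in
theorem monomial_singleton_comp (e : E) (x : E → Bool) :
    monomial {e} (x ∘ τ) = monomial {τ e} x := by
  simp [monomial]

theorem gibbsE_monomial_equiv (hH : ∀ x : E → Bool, H (x ∘ τ) = H x) (e : E) :
    gibbsE H (monomial {τ e}) = gibbsE H (monomial {e}) := by
  rw [← gibbsE_comp_equiv hH (monomial {e})]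
  simp only [monomial_singleton_comp]

theorem gibbsCov_monomial_equiv (hH : ∀ x : E → Bool, H (x ∘ τ) = H x) (e f : E) :
    gibbsCov H (monomial {τ e}) (monomial {τ f}) = gibbsCov H (monomial {e}) (monomial {f}) := by
  rw [gibbsCov, gibbsCov, gibbsE_monomial_equiv hH, gibbsE_monomial_equiv hH,
    ← gibbsE_comp_equiv hH fun x => monomial {e} x * monomial {f} x]
  simp only [monomial_singleton_comp]

end Symmetry

section Graph

variable {n m : ℕ}

/-- The permutation of the edges of the complete graph induced by a permutation of its vertices. -/
def edgePerm (σ : Equiv.Perm (Fin n)) : EdgeSet n ≃ EdgeSet n where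
  toFun e := ⟨Sym2.map σ e.1, fun h => e.2 ((Sym2.isDiag_map σ.injective).1 h)⟩
  invFun e := ⟨Sym2.map σ.symm e.1, fun h => e.2 ((Sym2.isDiag_map σ.symm.injective).1 h)⟩
  left_inv e := Subtype.ext (by simp [Sym2.map_map])
  right_inv e := Subtype.ext (by simp [Sym2.map_map])

theorem coe_edgePerm (σ : Equiv.Perm (Fin n)) (e : EdgeSet n) :
    (edgePerm σ e : Sym2 (Fin n)) = Sym2.map σ e := rfl

theorem exists_edgePerm_eq (e f : EdgeSet n) : ∃ σ, edgePerm σ e = f := by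
  obtain ⟨⟨a, b⟩, he⟩ := e
  obtain ⟨⟨c, d⟩, hf⟩ := f
  have hab : a ≠ b := fun h => he (Sym2.mk_isDiag_iff.2 h)
  have hcd : c ≠ d := fun h => hf (Sym2.mk_isDiag_iff.2 h)
  have h : Equiv.swap a c b ≠ c := by
    conv_rhs => rw [← Equiv.swap_apply_left a c]
    exact (Equiv.swap a c).injective.ne hab.symm
  refine ⟨Equiv.swap (Equiv.swap a c b) d * Equiv.swap a c, Subtype.ext ?_⟩
  change s(_, _) = s(c, d)
  simp [Equiv.swap_apply_of_ne_of_ne h.symm hcd]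

/-- An edge-pair weight invariant under vertex permutations is small off the diagonal when its
row sums are bounded. -/
theorem mul_le_of_edgePerm_invariant {w : EdgeSet n → EdgeSet n → ℝ} (hw : ∀ e f, 0 ≤ w e f)
    (hσ : ∀ σ e f, w (edgePerm σ e) (edgePerm σ f) = w e f) {e f : EdgeSet n} (hef : e ≠ f) :
    ((n : ℝ) - 3) * w e f ≤ ∑ g, w e g := by
  classical
  obtain ⟨b, hbf, hbe⟩ : ∃ b ∈ f.1, b ∉ e.1 := by
    by_contra! h
    obtain ⟨⟨a, b⟩, hf⟩ := f
    have hab : a ≠ b := fun h => hf (Sym2.mk_isDiag_iff.2 h)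
    exact hef (Subtype.ext ((Sym2.mem_and_mem_iff hab).1
      ⟨h a (Sym2.mem_mk_left _ _), h b (Sym2.mem_mk_right _ _)⟩))
  obtain ⟨a, hfab⟩ := Sym2.mem_iff_exists.1 hbf
  have hab : a ≠ b := fun h => f.2 (by rw [hfab, h]; simp)
  have hbad : ∀ v : Fin n, v ≠ b → v ≠ a → v ∉ e.1 →
      edgePerm (Equiv.swap b v) e = e := by
    intro v _ _ hve
    refine Subtype.ext ?_
    rw [coe_edgePerm]
    conv_rhs => rw [← id_eq (e : Sym2 (Fin n)), ← Sym2.map_id']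
    exact Sym2.map_congr fun u hu => Equiv.swap_apply_of_ne_of_ne
      (fun h => hbe (h ▸ hu)) (fun h => hve (h ▸ hu))
  set S : Finset (Fin n) := univ.filter fun v => v ≠ a ∧ v ∉ e.1 with hS
  have hwS : ∀ v ∈ S, w e (edgePerm (Equiv.swap b v) f) = w e f := by
    intro v hv
    obtain ⟨hva, hve⟩ : v ≠ a ∧ v ∉ e.1 := by simpa [hS] using hv
    by_cases hvb : v = b
    · subst hvb
      congr 1
      exact Subtype.ext (by simp [coe_edgePerm, Sym2.map_id])
    · conv_lhs => rw [← hbad v hvb hva hve]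
      exact hσ _ _ _
  have hinj : Set.InjOn (fun v => edgePerm (Equiv.swap b v) f) S := by
    intro v hv v' hv' h
    have h1 : v ≠ a := (by simpa [hS] using hv : v ≠ a ∧ v ∉ e.1).1
    have h2 : v' ≠ a := (by simpa [hS] using hv' : v' ≠ a ∧ v' ∉ e.1).1
    have := congrArg Subtype.val h
    simpa [coe_edgePerm, hfab, Equiv.swap_apply_of_ne_of_ne hab h1.symm,
      Equiv.swap_apply_of_ne_of_ne hab h2.symm, h1] using this
  have hcard : (n : ℝ) - 3 ≤ #S := by
    have : (univ : Finset (Fin n)) ⊆ S ∪ (insert a (univ.filter fun v => v ∈ e.1)) := by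
      intro v _
      by_cases h1 : v = a <;> by_cases h2 : v ∈ e.1 <;> simp [hS, h1, h2]
    have h1 := (card_le_card this).trans (card_union_le _ _)
    have h2 := card_insert_le a (univ.filter fun v => v ∈ e.1)
    have h3 : #(univ.filter fun v => v ∈ e.1) ≤ 2 := by
      obtain ⟨⟨c, d⟩, he⟩ := e
      refine (card_le_card fun v hv => ?_).trans (card_le_two (a := c) (b := d))
      simpa using hv
    rw [card_univ, Fintype.card_fin] at h1
    have : n ≤ #S + 3 := by omega
    have : (n : ℝ) ≤ #S + 3 := by exact_mod_cast this
    linarith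
  calc ((n : ℝ) - 3) * w e f ≤ #S * w e f := mul_le_mul_of_nonneg_right hcard (hw e f)
    _ = ∑ v ∈ S, w e (edgePerm (Equiv.swap b v) f) := by
      rw [sum_congr rfl hwS, sum_const, nsmul_eq_mul]
    _ = ∑ g ∈ S.image fun v => edgePerm (Equiv.swap b v) f, w e g := (sum_image hinj).symm
    _ ≤ ∑ g, w e g := sum_le_sum_of_subset_of_nonneg (subset_univ _) fun g _ _ => hw e g

open scoped Classical in
/-- The edges of the copy of `G` given by the injection `ψ`. -/
noncomputable def edgeImage (G : SimpleGraph (Fin m)) (ψ : Fin m ↪ Fin n) :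
    Finset (EdgeSet n) :=
  univ.filter fun e => ∃ z ∈ G.edgeSet, Sym2.map ψ z = e.1

theorem mem_edgeImage {G : SimpleGraph (Fin m)} {ψ : Fin m ↪ Fin n} {e : EdgeSet n} :
    e ∈ edgeImage G ψ ↔ ∃ z ∈ G.edgeSet, Sym2.map ψ z = e.1 := by
  simp [edgeImage]

theorem card_edgeImage (G : SimpleGraph (Fin m)) (ψ : Fin m ↪ Fin n) :
    #(edgeImage G ψ) = numEdges G := by
  have h : ((↑) : EdgeSet n → Sym2 (Fin n)) '' (edgeImage G ψ : Set (EdgeSet n)) =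
      Sym2.map ψ '' G.edgeSet := by
    ext z
    constructor
    · rintro ⟨e, he, rfl⟩
      exact mem_edgeImage.1 he
    · rintro ⟨z, hz, rfl⟩
      refine ⟨⟨Sym2.map ψ z, fun hd => G.not_isDiag_of_mem_edgeSet hz
        ((Sym2.isDiag_map ψ.injective).1 hd)⟩, mem_edgeImage.2 ⟨z, hz, rfl⟩, rfl⟩
  rw [numEdges, ← Set.ncard_image_of_injective _ (Sym2.map.injective ψ.injective), ← h,
    Set.ncard_image_of_injective _ Subtype.val_injective, Set.ncard_coe_finset]

theorem edgeInd_eq {x : Config n} {i j : Fin n} (h : ¬ s(i, j).IsDiag) :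
    edgeInd x i j = if x ⟨s(i, j), h⟩ = true then 1 else 0 := by
  simp only [edgeInd, edgeVal, dif_neg h]

theorem NG_eq_sum_monomial (G : SimpleGraph (Fin m)) (x : Config n) :
    NG G x = ∑ ψ : Fin m ↪ Fin n, monomial (edgeImage G ψ) x := by
  classical
  refine sum_congr rfl fun ψ _ => ?_
  have hd : ∀ {a b}, G.Adj a b → ¬ s(ψ a, ψ b).IsDiag := fun h hd =>
    h.ne (ψ.injective (Sym2.mk_isDiag_iff.1 hd))
  by_cases h : ∀ e ∈ edgeImage G ψ, x e = true
  · rw [monomial, if_pos h]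
    refine prod_eq_one fun a _ => prod_eq_one fun b _ => ?_
    split_ifs with hab
    · rw [edgeInd_eq (hd hab), if_pos (h _ (mem_edgeImage.2 ⟨s(a, b), hab, rfl⟩))]
    · rfl
  · rw [monomial, if_neg h]
    push Not at h
    obtain ⟨e, he, hx⟩ := h
    obtain ⟨⟨a, b⟩, hab, hz⟩ := mem_edgeImage.1 he
    refine prod_eq_zero (mem_univ a) (prod_eq_zero (mem_univ b) ?_)
    have hab' : G.Adj a b := hab
    have hee : (⟨s(ψ a, ψ b), hd hab'⟩ : EdgeSet n) = e := Subtype.ext hz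
    rw [if_pos hab', edgeInd_eq (hd hab'), hee, if_neg hx]

theorem edgePerm_mem_edgeImage {G : SimpleGraph (Fin m)} {ψ : Fin m ↪ Fin n}
    (σ : Equiv.Perm (Fin n)) {e : EdgeSet n} :
    edgePerm σ e ∈ edgeImage G (Equiv.embeddingCongr (Equiv.refl _) σ ψ) ↔
      e ∈ edgeImage G ψ := by
  rw [mem_edgeImage, mem_edgeImage]
  refine exists_congr fun z => and_congr_right fun _ => ?_
  rw [coe_edgePerm, ← (Sym2.map.injective σ.injective).eq_iff (a := Sym2.map ψ z),
    Sym2.map_map]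
  rfl

/-- The number of copies of `G` in the complete graph which use the edge `e`. -/
noncomputable def copyCount (G : SimpleGraph (Fin m)) (e : EdgeSet n) : ℕ :=
  #(univ.filter fun ψ : Fin m ↪ Fin n => e ∈ edgeImage G ψ)

theorem copyCount_edgePerm (G : SimpleGraph (Fin m)) (σ : Equiv.Perm (Fin n)) (e : EdgeSet n) :
    copyCount G (edgePerm σ e) = copyCount G e := by
  refine (card_equiv (Equiv.embeddingCongr (Equiv.refl _) σ) fun ψ => ?_).symm
  simp only [mem_filter, mem_univ, true_and, edgePerm_mem_edgeImage]

theorem choose_mul_copyCount (G : SimpleGraph (Fin m)) (e : EdgeSet n) :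
    n.choose 2 * copyCount G e = numEdges G * n.descFactorial m := by
  have h1 : ∑ f : EdgeSet n, copyCount G f = n.choose 2 * copyCount G e := by
    rw [sum_congr rfl fun f _ => show copyCount G f = copyCount G e by
      obtain ⟨σ, rfl⟩ := exists_edgePerm_eq e f
      exact copyCount_edgePerm G σ e]
    rw [sum_const, card_univ, Sym2.card_subtype_not_diag, Fintype.card_fin, smul_eq_mul]
  have h2 := sum_card_bipartiteAbove_eq_sum_card_bipartiteBelow
    (s := (univ : Finset (EdgeSet n))) (t := (univ : Finset (Fin m ↪ Fin n)))
    fun f ψ => f ∈ edgeImage G ψ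
  rw [← h1]
  refine h2.trans ?_
  simp [bipartiteBelow, card_edgeImage, mul_comm]

theorem two_le_of_numEdges_ne_zero {G : SimpleGraph (Fin m)} (h : numEdges G ≠ 0) : 2 ≤ m := by
  obtain ⟨⟨a, b⟩, hab⟩ := Set.nonempty_of_ncard_ne_zero h
  have hab' : a ≠ b := G.ne_of_adj hab
  have := a.2
  have := b.2
  have : a.1 ≠ b.1 := Fin.val_ne_of_ne hab'
  omega

theorem copyCount_eq (G : SimpleGraph (Fin m)) (e : EdgeSet n) :
    copyCount G e = 2 * numEdges G * (n - 2).descFactorial (m - 2) := by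
  have hn : 2 ≤ n := by
    obtain ⟨⟨a, b⟩, he⟩ := e
    have : a.1 ≠ b.1 := fun h => he (Sym2.mk_isDiag_iff.2 (Fin.ext h))
    have := a.2
    have := b.2
    omega
  have h := choose_mul_copyCount G e
  have hc : 0 < n.choose 2 := Nat.choose_pos hn
  rcases eq_or_ne (numEdges G) 0 with h0 | h0
  · rw [h0, zero_mul, mul_eq_zero] at h
    rw [h0, h.resolve_left hc.ne']
    simp
  · obtain ⟨k, rfl⟩ := Nat.exists_eq_add_of_le' (two_le_of_numEdges_ne_zero h0)
    obtain ⟨l, rfl⟩ := Nat.exists_eq_add_of_le' hn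
    have hch : (l + 2) * (l + 1) = 2 * (l + 2).choose 2 := by
      rw [Nat.choose_two_right, Nat.mul_div_cancel' (Nat.even_mul_pred_self _).two_dvd]
      rfl
    have hdf : (l + 2).descFactorial (k + 2) = (l + 2) * (l + 1) * l.descFactorial k := by
      rw [Nat.succ_descFactorial_succ, Nat.succ_descFactorial_succ, mul_assoc]
    rw [hdf, hch] at h
    refine Nat.eq_of_mul_eq_mul_left hc ?_
    rw [h]
    simp only [Nat.add_sub_cancel]
    ring

theorem copyCount_div_le (G : SimpleGraph (Fin m)) (e : EdgeSet n) :
    (copyCount G e : ℝ) / (n : ℝ) ^ (m - 2) ≤ 2 * numEdges G := by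
  refine div_le_of_le_mul₀ (by positivity) (by positivity) ?_
  have := (Nat.descFactorial_le_pow (n - 2) (m - 2)).trans (Nat.pow_le_pow_left (Nat.sub_le n 2) _)
  rw [copyCount_eq]
  push_cast
  gcongr
  exact_mod_cast this

theorem le_copyCount_div (G : SimpleGraph (Fin m)) (e : EdgeSet n) :
    2 * numEdges G * (1 - (m : ℝ) ^ 2 / n) ≤ (copyCount G e : ℝ) / (n : ℝ) ^ (m - 2) := by
  rcases eq_or_ne (numEdges G) 0 with h0 | h0
  · simp only [h0, Nat.cast_zero, mul_zero, zero_mul]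
    positivity
  have hm := two_le_of_numEdges_ne_zero h0
  have hn0 : 0 < n := by
    obtain ⟨⟨a, b⟩, he⟩ := e
    exact a.pos
  have hn : (0 : ℝ) < n := by exact_mod_cast hn0
  rcases lt_or_ge n m with hnm | hnm
  · refine le_trans ?_ (by positivity : (0 : ℝ) ≤ _)
    refine mul_nonpos_of_nonneg_of_nonpos (by positivity) ?_
    rw [sub_nonpos, one_le_div hn]
    have : (n : ℝ) ≤ m := by exact_mod_cast hnm.le
    have : (1 : ℝ) ≤ m := by exact_mod_cast (by omega : 1 ≤ m)
    nlinarith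
  · have h1 := Nat.pow_sub_le_descFactorial (n - 2) (m - 2)
    have h2 : n - 2 + 1 - (m - 2) = n + 1 - m := by omega
    rw [h2] at h1
    have h3 : ((n : ℝ) + 1 - m) ^ (m - 2) ≤ ((n - 2).descFactorial (m - 2) : ℕ) := by
      have : ((n : ℝ) + 1 - m) = ((n + 1 - m : ℕ) : ℝ) := by
        rw [Nat.cast_sub (by omega)]; push_cast; ring
      rw [this]
      exact_mod_cast h1
    have hm' : (1 : ℝ) ≤ m := by exact_mod_cast (by omega : 1 ≤ m)
    have hnm' : (m : ℝ) ≤ n := by exact_mod_cast hnm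
    have h4 : 1 + ((m - 2 : ℕ) : ℝ) * (-((m - 1) / n)) ≤ (1 + -(((m : ℝ) - 1) / n)) ^ (m - 2) := by
      refine one_add_mul_le_pow ?_ _
      have : ((m : ℝ) - 1) / n ≤ 1 := by rw [div_le_one hn]; linarith
      linarith
    have h5 : 1 - (m : ℝ) ^ 2 / n ≤ 1 + ((m - 2 : ℕ) : ℝ) * (-((m - 1) / n)) := by
      have : ((m - 2 : ℕ) : ℝ) * ((m - 1) / n) ≤ m * (m / n) := by
        have : ((m - 2 : ℕ) : ℝ) ≤ m := by exact_mod_cast Nat.sub_le _ _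
        have : (0 : ℝ) ≤ m - 1 := by linarith
        gcongr
        linarith
      rw [← mul_div_assoc (m : ℝ), ← sq] at this
      linarith
    rw [copyCount_eq]
    push_cast
    rw [mul_div_assoc]
    refine mul_le_mul_of_nonneg_left ((h5.trans h4).trans ?_) (by positivity)
    rw [le_div_iff₀ (by positivity), ← mul_pow]
    rwa [show (1 + -(((m : ℝ) - 1) / n)) * n = n + 1 - m by field_simp; ring]

end Graph

section HamiltonianPoly

variable {s n : ℕ} (V : Fin s → ℕ) (G : ∀ i, SimpleGraph (Fin (V i))) (β : Fin s → ℝ)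

/-- The coefficient with which a copy of `G_i` enters the Hamiltonian. -/
noncomputable def copyCoef (j : Σ i, Fin (V i) ↪ Fin n) : ℝ := β j.1 / (n : ℝ) ^ (V j.1 - 2)

/-- The edges of a copy of one of the graphs `G_i`. -/
noncomputable def copyEdges (j : Σ i, Fin (V i) ↪ Fin n) : Finset (EdgeSet n) :=
  edgeImage (G j.1) j.2

theorem card_copyEdges (j : Σ i, Fin (V i) ↪ Fin n) :
    #(copyEdges V G j) = numEdges (G j.1) := card_edgeImage _ _

theorem Hamiltonian_eq_poly :
    (Hamiltonian V G β : Config n → ℝ) = poly (copyCoef V β) (copyEdges V G) := by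
  funext x
  simp only [Hamiltonian, poly, Fintype.sum_sigma, NG_eq_sum_monomial, copyCoef, copyEdges,
    mul_sum, sum_div]
  exact sum_congr rfl fun i _ => sum_congr rfl fun ψ _ => by ring

theorem sum_copies_eq (e : EdgeSet n) (F : Fin s → ℝ) :
    (∑ j : Σ i, Fin (V i) ↪ Fin n, if e ∈ copyEdges V G j then copyCoef V β j * F j.1 else 0) =
      ∑ i, β i * (copyCount (G i) e / (n : ℝ) ^ (V i - 2)) * F i := by
  rw [Fintype.sum_sigma]
  refine sum_congr rfl fun i _ => ?_
  rw [sum_congr rfl fun ψ _ => show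
    (if e ∈ copyEdges V G ⟨i, ψ⟩ then copyCoef V β ⟨i, ψ⟩ * F i else 0) =
      if e ∈ edgeImage (G i) ψ then β i / (n : ℝ) ^ (V i - 2) * F i else 0 from rfl,
    ← sum_filter, sum_const, nsmul_eq_mul, copyCount]
  ring

variable {β} (hβ : ∀ i, 0 < β i)
include hβ

theorem copyCoef_nonneg (j : Σ i, Fin (V i) ↪ Fin n) : 0 ≤ copyCoef V β j := by
  have := (hβ j.1).le
  unfold copyCoef
  positivity

theorem sum_copies_le (e : EdgeSet n) {F : Fin s → ℝ} (hF : ∀ i, 0 ≤ F i) :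
    (∑ j : Σ i, Fin (V i) ↪ Fin n, if e ∈ copyEdges V G j then copyCoef V β j * F j.1 else 0) ≤
      ∑ i, 2 * β i * numEdges (G i) * F i := by
  rw [sum_copies_eq]
  refine sum_le_sum fun i _ => mul_le_mul_of_nonneg_right ?_ (hF i)
  have := mul_le_mul_of_nonneg_left (copyCount_div_le (G i) e) (hβ i).le
  linarith

theorem Hamiltonian_supermodular (a b : Config n) :
    Hamiltonian V G β a + Hamiltonian V G β b ≤
      Hamiltonian V G β (a ⊓ b) + Hamiltonian V G β (a ⊔ b) := by
  rw [Hamiltonian_eq_poly]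
  exact poly_supermodular (copyCoef_nonneg V hβ) _ a b

theorem monotone_discDeriv_Hamiltonian (e : EdgeSet n) :
    Monotone (discDeriv e (Hamiltonian V G β)) := by
  rw [Hamiltonian_eq_poly]
  exact monotone_discDeriv_poly (copyCoef_nonneg V hβ) _ e

theorem monotone_discDeriv_derivSum_Hamiltonian (e : EdgeSet n) :
    Monotone (discDeriv e (derivSum (Hamiltonian V G β))) := by
  rw [Hamiltonian_eq_poly, derivSum_poly]
  refine monotone_discDeriv_poly (fun q => ?_) _ e
  have := copyCoef_nonneg V hβ q.2
  split_ifs <;> simp [this]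

theorem abs_resampleList_discDeriv_sub_Psi_le {t : ℝ} (ht : t ∈ Set.Icc (0 : ℝ) 1)
    (e : EdgeSet n) (x : Config n) :
    |resampleList t univ.toList (discDeriv e (Hamiltonian V G β)) x - Psi V G β t| ≤
      (∑ i, 2 * β i * numEdges (G i) * (V i : ℝ) ^ 2) / n := by
  rw [Hamiltonian_eq_poly, resampleList_discDeriv_poly]
  simp only [card_copyEdges]
  rw [sum_copies_eq V G β e fun i => t ^ (numEdges (G i) - 1), Psi, ← sum_sub_distrib, sum_div]
  refine (abs_sum_le_sum_abs _ _).trans (sum_le_sum fun i _ => ?_)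
  have h1 := copyCount_div_le (G i) e
  have h2 := le_copyCount_div (G i) e
  have h3 : t ^ (numEdges (G i) - 1) ≤ 1 := pow_le_one₀ ht.1 ht.2
  have h4 : 0 ≤ t ^ (numEdges (G i) - 1) := pow_nonneg ht.1 _
  rw [← sub_mul, abs_mul, abs_of_nonneg h4]
  refine (mul_le_of_le_one_right (abs_nonneg _) h3).trans ?_
  rw [mul_comm 2, mul_assoc, ← mul_sub, abs_mul, abs_of_pos (hβ i), mul_assoc (β i), mul_div_assoc]
  refine mul_le_mul_of_nonneg_left ?_ (hβ i).le
  rw [abs_le, mul_div_assoc]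
  have : 0 ≤ 2 * (numEdges (G i) : ℝ) * ((V i : ℝ) ^ 2 / n) := by positivity
  constructor <;> linarith

theorem resampleList_discDeriv_derivSum_le {t : ℝ} (ht : t ∈ Set.Icc (0 : ℝ) 1)
    (e : EdgeSet n) (x : Config n) :
    resampleList t univ.toList (discDeriv e (derivSum (Hamiltonian V G β))) x ≤
      ∑ i, 2 * β i * numEdges (G i) * ((numEdges (G i) - 1 : ℕ) * t ^ (numEdges (G i) - 2)) := by
  rw [Hamiltonian_eq_poly, resampleList_discDeriv_derivSum_poly]
  simp only [card_copyEdges]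
  exact sum_copies_le V G hβ e
    (F := fun i => (numEdges (G i) - 1 : ℕ) * t ^ (numEdges (G i) - 2))
    fun i => mul_nonneg (Nat.cast_nonneg _) (pow_nonneg ht.1 _)

omit hβ in
theorem Hamiltonian_comp_edgePerm (σ : Equiv.Perm (Fin n)) (x : Config n) :
    Hamiltonian V G β (x ∘ edgePerm σ) = Hamiltonian V G β x := by
  rw [Hamiltonian_eq_poly]
  exact poly_comp_equiv (ρ := Equiv.sigmaCongrRight fun _ =>
    Equiv.embeddingCongr (Equiv.refl _) σ) (fun _ => rfl) (fun _ _ => edgePerm_mem_edgeImage σ) x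

omit hβ in
theorem pairWeight_edgePerm (σ : Equiv.Perm (Fin n)) (e f : EdgeSet n) :
    pairWeight (copyCoef V β) (copyEdges V G) (edgePerm σ e) (edgePerm σ f) =
      pairWeight (copyCoef V β) (copyEdges V G) e f :=
  pairWeight_equiv (ρ := Equiv.sigmaCongrRight fun _ =>
    Equiv.embeddingCongr (Equiv.refl _) σ) (fun _ => rfl) (fun _ _ => edgePerm_mem_edgeImage σ) e f

omit hβ in
/-- An invariant pair weight with bounded row sums is of order `1 / n` off the diagonal. -/
theorem le_div_of_edgePerm_invariant {w : EdgeSet n → EdgeSet n → ℝ} (hw : ∀ e f, 0 ≤ w e f)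
    (hσ : ∀ σ e f, w (edgePerm σ e) (edgePerm σ f) = w e f) {L : ℝ}
    (hL : ∀ e, ∑ f, w e f ≤ L) {e f : EdgeSet n} (hef : e ≠ f) : w e f ≤ 6 * L / n := by
  have hn : (0 : ℝ) < n := by
    obtain ⟨⟨a, b⟩, he⟩ := e
    exact_mod_cast a.pos
  rw [le_div_iff₀ hn]
  have h1 := (mul_le_of_edgePerm_invariant hw hσ hef).trans (hL e)
  have h2 := (single_le_sum (fun g _ => hw e g) (mem_univ f)).trans (hL e)
  have h0 := hw e f
  rcases le_or_gt (n : ℝ) 6 with h | h <;> nlinarith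

/-- The discrete derivatives of the Hamiltonian and of `derivSum` have small influences. -/
theorem exists_influence_bound : ∃ L : ℝ, 0 < L ∧ ∀ (n : ℕ) (e : EdgeSet n),
    ∀ g ∈ ({discDeriv e (Hamiltonian V G β), discDeriv e (derivSum (Hamiltonian V G β))} :
      Set (Config n → ℝ)),
    ∃ b : EdgeSet n → ℝ, (∀ f x, discDeriv f g x ∈ Set.Icc 0 (b f)) ∧ (∀ f, b f ≤ L / n) ∧
      ∑ f, b f ≤ L := by
  set L₀ : ℝ := ∑ i, 2 * β i * numEdges (G i) * numEdges (G i) with hL₀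
  have hL₀0 : 0 ≤ L₀ := sum_nonneg fun i _ => by have := (hβ i).le; positivity
  set r : ℕ := 1 + ∑ i, numEdges (G i) with hr
  refine ⟨r * (6 * L₀) + 1, by positivity, fun n e g hg => ?_⟩
  have hc := copyCoef_nonneg (n := n) V hβ
  set w := pairWeight (copyCoef (n := n) V β) (copyEdges V G) with hw
  have hw0 : ∀ e f, 0 ≤ w e f := pairWeight_nonneg hc _
  have hwsum : ∀ e, ∑ f, w e f ≤ L₀ := by
    intro e
    rw [hw, sum_pairWeight]
    simp only [card_copyEdges]
    exact sum_copies_le V G hβ e (F := fun i => (numEdges (G i) : ℝ)) fun i => Nat.cast_nonneg _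
  refine ⟨fun f => r * if f = e then 0 else w e f, ?_, fun f => ?_, ?_⟩
  · intro f x
    have hr1 : (1 : ℝ) ≤ r := by exact_mod_cast (by omega : 1 ≤ r)
    rcases hg with rfl | rfl
    · rw [Hamiltonian_eq_poly]
      have h := discDeriv_discDeriv_poly_mem_Icc hc (copyEdges V G) e f x
      exact ⟨h.1, h.2.trans (le_mul_of_one_le_left (h.1.trans h.2) hr1)⟩
    · rw [Hamiltonian_eq_poly, derivSum_poly]
      have h := discDeriv_discDeriv_poly_mem_Icc
        (c := fun q : EdgeSet n × _ => if q.1 ∈ copyEdges V G q.2 then copyCoef V β q.2 else 0)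
        (fun q => by have := hc q.2; split_ifs <;> simp [this])
        (fun q => (copyEdges V G q.2).erase q.1) e f x
      refine ⟨h.1, h.2.trans ?_⟩
      dsimp only
      split_ifs with hfe
      · simp
      · refine pairWeight_derivSum_le hc (copyEdges V G) (fun j => ?_) e f
        rw [card_copyEdges]
        have := single_le_sum (f := fun i => numEdges (G i)) (fun _ _ => Nat.zero_le _)
          (mem_univ j.1)
        omega
  · dsimp only
    split_ifs with hfe
    · rw [mul_zero]; positivity
    · calc (r : ℝ) * w e f ≤ r * (6 * L₀ / n) := by
            gcongr
            exact le_div_of_edgePerm_invariant hw0 (pairWeight_edgePerm V G) hwsum (Ne.symm hfe)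
        _ = r * (6 * L₀) / n := by ring
        _ ≤ _ := by gcongr; linarith
  · rw [← mul_sum]
    have : ∑ f, (if f = e then 0 else w e f) ≤ L₀ :=
      (sum_le_sum fun f _ => by split_ifs <;> simp [hw0]).trans (hwsum e)
    have h1 : (r : ℝ) * ∑ f, (if f = e then 0 else w e f) ≤ r * L₀ := by gcongr
    have h2 : 0 ≤ (r : ℝ) * L₀ := by positivity
    linarith

end HamiltonianPoly

section Calculus

theorem contDiff_Phi : ContDiff ℝ 1 Phi := by
  unfold Phi
  exact Real.contDiff_exp.div (contDiff_const.add Real.contDiff_exp) fun x =>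
    (by positivity : 1 + Real.exp x ≠ 0)

theorem exists_lipschitz_Phi {u K : ℝ} (hK : deriv Phi u < K) : ∃ ε > 0,
    ∀ v ∈ Set.Icc (u - ε) (u + ε), ∀ w ∈ Set.Icc (u - ε) (u + ε), v ≤ w →
      Phi w - Phi v ≤ K * (w - v) := by
  have h := contDiff_Phi.contDiffAt.hasStrictDerivAt (x := u) one_ne_zero
  have h1 := h.isLittleO.def (sub_pos.2 hK)
  rw [nhds_prod_eq, (Metric.nhds_basis_closedBall.prod_self).eventually_iff] at h1
  obtain ⟨ε, hε, h2⟩ := h1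
  refine ⟨ε, hε, fun v hv w hw hvw => ?_⟩
  rw [← Real.closedBall_eq_Icc] at hv hw
  have h3 := h2 (x := (w, v)) ⟨hw, hv⟩
  simp only [Real.norm_eq_abs, abs_of_nonneg (sub_nonneg.2 hvw)] at h3
  have h4 := (le_abs_self _).trans h3
  simp [ContinuousLinearMap.toSpanSingleton_apply] at h4
  linarith

/-- A property of reals which propagates from `v` to every `w > ρ v` holds above `v₀`, if `ρ` is
below the identity there. -/
theorem forall_gt_of_contracting {P : ℝ → Prop} {ρ : ℝ → ℝ} (hρ : Continuous ρ) {v₀ B : ℝ}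
    (hv₀ : ∀ v, v₀ < v → ρ v < v) (hB : ∀ v, B < v → P v)
    (hstep : ∀ v w, P v → ρ v < w → P w) {v : ℝ} (hv : v₀ < v) : P v := by
  by_contra hPv
  set S : Set ℝ := {w | v ≤ w ∧ P w} with hS
  have hne : S.Nonempty := ⟨max v (B + 1), le_max_left _ _,
    hB _ (lt_of_lt_of_le (lt_add_one B) (le_max_right _ _))⟩
  have hbdd : BddBelow S := ⟨v, fun w hw => hw.1⟩
  have hm : v ≤ sInf S := le_csInf hne fun w hw => hw.1
  have hlt := hv₀ _ (hv.trans_le hm)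
  obtain ⟨c, hc1, hc2⟩ := exists_between hlt
  have hev : ∀ᶠ w in nhds (sInf S), ρ w < c := hρ.continuousAt.eventually_lt_const hc1
  obtain ⟨δ, hδ, hball⟩ := Metric.eventually_nhds_iff.1 hev
  obtain ⟨w, hwS, hw⟩ := exists_lt_of_csInf_lt hne (lt_add_of_pos_right (sInf S) hδ)
  have hw' := csInf_le hbdd hwS
  have hρw : ρ w < c := hball (by rw [Real.dist_eq, abs_of_nonneg (by linarith)]; linarith)
  have hmax : P (max v c) := hstep w _ hwS.2 (hρw.trans_le (le_max_right _ _))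
  rcases max_cases v c with h | h
  · exact hPv (h.1 ▸ hmax)
  · rw [h.1] at hmax
    exact absurd (csInf_le hbdd (show c ∈ S from ⟨h.2.le, hmax⟩)) (not_le.2 hc2)

end Calculus

section Negligible

/-- Decay faster than every power of `n`, uniformly over edges. -/
def Negligible (u : ∀ n, EdgeSet n → ℝ) : Prop :=
  ∀ k : ℕ, ∃ N : ℕ, ∀ n, N ≤ n → ∀ e, u n e * (n : ℝ) ^ k ≤ 1

theorem card_edgeSet_le (n : ℕ) : (Fintype.card (EdgeSet n) : ℝ) ≤ (n : ℝ) ^ 2 / 2 := by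
  rw [Sym2.card_subtype_not_diag, Fintype.card_fin, Nat.cast_choose_two]
  nlinarith [Nat.cast_nonneg (α := ℝ) n]

theorem Negligible.of_le {u u' : ∀ n, EdgeSet n → ℝ} (hu : Negligible u) {γ : ℝ} (hγ : 0 < γ)
    {N : ℕ} (h : ∀ n, N ≤ n → ∀ e, u' n e ≤ Real.exp (-γ * n) + ∑ f, u n f) :
    Negligible u' := by
  intro k
  obtain ⟨N₁, hN₁⟩ := hu (k + 2)
  have hlim : Tendsto (fun n : ℕ => (n : ℝ) ^ k * Real.exp (-γ * n)) atTop (nhds 0) := by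
    refine (tendsto_pow_const_mul_const_pow_of_lt_one k (Real.exp_pos (-γ)).le
      (Real.exp_lt_one_iff.2 (neg_lt_zero.2 hγ))).congr fun n => ?_
    rw [← Real.exp_nat_mul, mul_comm (n : ℝ) (-γ)]
  obtain ⟨N₂, hN₂⟩ := eventually_atTop.1 (hlim.eventually_lt_const (by norm_num : (0 : ℝ) < 1 / 2))
  refine ⟨max 1 (max N (max N₁ N₂)), fun n hn e => ?_⟩
  simp only [max_le_iff] at hn
  have hn0 : (0 : ℝ) < n := by exact_mod_cast hn.1
  have h1 := hN₂ n hn.2.2.2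
  have h2 : (∑ f, u n f) * (n : ℝ) ^ k ≤ 1 / 2 := by
    have h3 : (∑ f, u n f) * (n : ℝ) ^ (k + 2) ≤ (n : ℝ) ^ 2 / 2 := by
      rw [sum_mul]
      refine (sum_le_sum fun f _ => hN₁ n hn.2.2.1 f).trans ?_
      simpa using card_edgeSet_le n
    rw [pow_add, ← mul_assoc] at h3
    have : (0 : ℝ) < (n : ℝ) ^ 2 := by positivity
    nlinarith
  have h4 := mul_le_mul_of_nonneg_right (h n hn.2.1 e) (pow_nonneg hn0.le k)
  rw [add_mul, mul_comm (Real.exp _)] at h4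
  linarith

end Negligible

section Deviation

/-- The deviation bound for functions whose influences are of order `1 / n`. -/
theorem gibbsP_deviation_le_exp {E : Type*} [Fintype E] [DecidableEq E] (H : (E → Bool) → ℝ)
    {s t : ℝ} (hs : s = 1 ∨ s = -1) (ht : t ∈ Set.Icc (0 : ℝ) 1) {g : (E → Bool) → ℝ}
    {b : E → ℝ} {L η θ : ℝ} (hL : 0 < L) (hη : 0 < η) {n : ℕ} (hn : 0 < n)
    (hb : ∀ e x, discDeriv e g x ∈ Set.Icc 0 (b e)) (hbn : ∀ e, b e ≤ L / n)
    (hbL : ∑ e, b e ≤ L) (hg : ∀ x, s * (resampleList t univ.toList g x - θ) ≤ -η) :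
    gibbsP H {x | 0 < s * (g x - θ)} ≤
      Real.exp (-(min (1 / L) (η / (2 * L ^ 2)) * η / 2) * n) +
        ∑ e, gibbsP H {x | 0 < s * (Phi (discDeriv e H x) - t)} := by
  set τ := min (1 / L) (η / (2 * L ^ 2)) with hτ
  have hτ0 : 0 < τ := by positivity
  have hn' : (0 : ℝ) < n := by exact_mod_cast hn
  have hτL : τ * L ≤ 1 := (le_div_iff₀ hL).1 (min_le_left _ _)
  have hτη : τ * (2 * L ^ 2) ≤ η := (le_div_iff₀ (by positivity)).1 (min_le_right _ _)
  have hb0 : ∀ e, 0 ≤ b e := fun e => (hb e ⊥).1.trans (hb e ⊥).2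
  refine (gibbsP_deviation_le H hs ht hb (r := τ * n) (by positivity) (fun e => ?_) hg).trans ?_
  · calc τ * n * b e ≤ τ * n * (L / n) := by have := hbn e; gcongr
      _ = τ * L := by field_simp
      _ ≤ 1 := hτL
  · gcongr
    have h1 : ∑ e, b e ^ 2 ≤ L / n * L := by
      calc ∑ e, b e ^ 2 ≤ ∑ e, L / n * b e := sum_le_sum fun e _ => by
            rw [sq]; exact mul_le_mul_of_nonneg_right (hbn e) (hb0 e)
        _ ≤ L / n * L := by rw [← mul_sum]; gcongr
    have h2 : (τ * n) ^ 2 * ∑ e, b e ^ 2 ≤ (τ * n) ^ 2 * (L / n * L) := by gcongr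
    have h3 : (τ * n) ^ 2 * (L / n * L) = τ * n * (τ * (2 * L ^ 2)) / 2 := by field_simp
    have h4 : τ * n * (τ * (2 * L ^ 2)) ≤ τ * n * η := by gcongr
    linarith

variable {s : ℕ} (V : Fin s → ℕ) (G : ∀ i, SimpleGraph (Fin (V i))) (β : Fin s → ℝ)

/-- Deviations of `∂_e H` above `u` (for `σ = 1`) or below `u` (for `σ = -1`) are negligible. -/
def NegligibleDeviation (σ u : ℝ) : Prop :=
  Negligible fun n e => gibbsP (Hamiltonian (n := n) V G β)
    {x | 0 < σ * (discDeriv e (Hamiltonian V G β) x - u)}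

variable {V G β} {σ : ℝ}

theorem mul_Phi_sub_pos_iff (hσ : σ = 1 ∨ σ = -1) {u v : ℝ} :
    0 < σ * (Phi u - Phi v) ↔ 0 < σ * (u - v) := by
  rcases hσ with rfl | rfl <;> simp [Phi_strictMono.lt_iff_lt]

theorem NegligibleDeviation.negligible (hσ : σ = 1 ∨ σ = -1) {u : ℝ}
    (hu : NegligibleDeviation V G β σ u) {g : ∀ n, EdgeSet n → Config n → ℝ} {L : ℝ} (hL : 0 < L)
    (hg : ∀ n e, ∃ b : EdgeSet n → ℝ, (∀ f x, discDeriv f (g n e) x ∈ Set.Icc 0 (b f)) ∧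
      (∀ f, b f ≤ L / n) ∧ ∑ f, b f ≤ L)
    {θ η : ℝ} (hη : 0 < η) {N : ℕ} (hθ : ∀ n, N ≤ n → ∀ e x,
      σ * (resampleList (Phi u) univ.toList (g n e) x - θ) ≤ -η) :
    Negligible fun n e => gibbsP (Hamiltonian V G β) {x | 0 < σ * (g n e x - θ)} := by
  refine Negligible.of_le hu (γ := min (1 / L) (η / (2 * L ^ 2)) * η / 2) (by positivity)
    (N := max N 1) fun n hn e => ?_
  obtain ⟨b, hb, hbn, hbL⟩ := hg n e
  have := gibbsP_deviation_le_exp (Hamiltonian V G β) hσ (Phi_mem_Icc u) hL hη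
    (lt_of_lt_of_le one_pos ((le_max_right _ _).trans hn)) hb hbn hbL
    (hθ n ((le_max_left _ _).trans hn) e)
  simpa only [mul_Phi_sub_pos_iff hσ] using this

variable (hβ : ∀ i, 0 < β i)
include hβ

theorem NegligibleDeviation.step (hσ : σ = 1 ∨ σ = -1) {u u' : ℝ}
    (hu : NegligibleDeviation V G β σ u) (h : 0 < σ * (u' - Psi V G β (Phi u))) :
    NegligibleDeviation V G β σ u' := by
  obtain ⟨L, hL, hinf⟩ := exists_influence_bound V G hβ
  set C := ∑ i, 2 * β i * numEdges (G i) * (V i : ℝ) ^ 2 with hC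
  set η := σ * (u' - Psi V G β (Phi u)) / 2 with hη
  have hη0 : 0 < η := by positivity
  refine hu.negligible hσ hL (fun n e => hinf n e _ (Or.inl rfl)) hη0 (N := ⌈C / η⌉₊ + 1)
    fun n hn e x => ?_
  have h1 := abs_resampleList_discDeriv_sub_Psi_le V G hβ (Phi_mem_Icc u) e x
  have h2 : C / n ≤ η := by
    have hn' : (⌈C / η⌉₊ : ℝ) + 1 ≤ n := by exact_mod_cast hn
    have := Nat.le_ceil (C / η)
    have hn0 : (0 : ℝ) < n := by have := Nat.cast_nonneg (α := ℝ) ⌈C / η⌉₊; linarith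
    rw [div_le_iff₀ hn0, mul_comm, ← div_le_iff₀ hη0]
    linarith
  have h3 := abs_le.1 (h1.trans h2)
  rcases hσ with rfl | rfl <;> linarith [h3.1, h3.2]

theorem Psi_mem_Icc {t : ℝ} (ht : t ∈ Set.Icc (0 : ℝ) 1) :
    Psi V G β t ∈ Set.Icc 0 (Psi V G β 1) := by
  unfold Psi
  constructor
  · exact sum_nonneg fun i _ => by
      have := (hβ i).le; have := pow_nonneg ht.1 (numEdges (G i) - 1); positivity
  · refine sum_le_sum fun i _ => ?_
    have := (hβ i).le
    rw [one_pow]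
    exact mul_le_mul_of_nonneg_left (pow_le_one₀ ht.1 ht.2) (by positivity)

theorem discDeriv_Hamiltonian_mem_Icc {n : ℕ} (e : EdgeSet n) (x : Config n) :
    discDeriv e (Hamiltonian V G β) x ∈ Set.Icc 0 (Psi V G β 1) := by
  rw [Hamiltonian_eq_poly, discDeriv_poly]
  have h := poly_mem_Icc (c := fun j => if e ∈ copyEdges V G j then copyCoef V β j else 0)
    (fun j => by have := copyCoef_nonneg V hβ j; split_ifs <;> simp [this])
    (fun j => (copyEdges V G j).erase e) x
  refine ⟨h.1, h.2.trans ?_⟩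
  have h2 := sum_copies_le V G hβ e (F := fun _ => 1) fun _ => zero_le_one
  simpa [Psi] using h2

theorem NegligibleDeviation.of_large (hσ : σ = 1 ∨ σ = -1) {v : ℝ} (hv : Psi V G β 1 < v) :
    NegligibleDeviation V G β σ (σ * v) := by
  refine fun k => ⟨0, fun n _ e => ?_⟩
  have : {x | 0 < σ * (discDeriv e (Hamiltonian V G β) x - σ * v)} = (∅ : Set (Config n)) := by
    refine Set.eq_empty_of_forall_notMem fun x hx => ?_
    have h := discDeriv_Hamiltonian_mem_Icc hβ e x (V := V) (G := G)
    rw [Set.mem_ofPred_eq] at hx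
    rcases hσ with rfl | rfl <;> linarith [h.1, h.2]
  dsimp only
  rw [this, gibbsP, Set.indicator_empty,
    gibbsE_const, zero_mul]
  exact zero_le_one

omit hβ in
theorem continuous_Psi : Continuous (Psi V G β) := by
  unfold Psi; fun_prop

/-- In the subcritical regime `∂_e H` concentrates at `Ψ(p)`. -/
theorem negligibleDeviation_of_subcritical {p : ℝ} (hsub : Subcritical V G β p)
    (hσ : σ = 1 ∨ σ = -1) {u : ℝ} (hu : 0 < σ * (u - Psi V G β p)) :
    NegligibleDeviation V G β σ u := by
  have hσσ : σ * σ = 1 := by rcases hσ with rfl | rfl <;> norm_num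
  set ρ : ℝ → ℝ := fun v => σ * Psi V G β (Phi (σ * v)) with hρ
  have hρc : Continuous ρ :=
    continuous_const.mul (continuous_Psi.comp (contDiff_Phi.continuous.comp
      (continuous_const.mul continuous_id)))
  have hρB : ∀ v, ρ v ≤ Psi V G β 1 := by
    intro v
    have := Psi_mem_Icc hβ (V := V) (G := G) (Phi_mem_Icc (σ * v))
    rcases hσ with rfl | rfl <;> simp only [hρ] <;> linarith [this.1, this.2]
  have hfix : ∀ v, σ * Psi V G β p < v → ρ v ≠ v := by
    intro v hv h
    have h1 : Psi V G β (Phi (σ * v)) = σ * v := by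
      rw [← one_mul (Psi V G β _), ← hσσ, mul_assoc]
      exact congrArg (σ * ·) h
    have h2 : Phi (σ * v) = p := hsub.2.1 _ (by simp only [phiFn, h1])
    rw [h2] at h1
    rw [h1, ← mul_assoc, hσσ, one_mul] at hv
    exact lt_irrefl _ hv
  have hv₀ : ∀ v, σ * Psi V G β p < v → ρ v < v := by
    intro v hv
    by_contra! hle
    set w := max v (Psi V G β 1) with hw
    obtain ⟨z, hz, hz'⟩ := intermediate_value_Icc (le_max_left v (Psi V G β 1))
      (f := fun v => v - ρ v) (continuous_id.sub hρc).continuousOn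
      (show (0 : ℝ) ∈ Set.Icc _ _ from ⟨by linarith, by
        have := hρB w; have := le_max_right v (Psi V G β 1); linarith⟩)
    exact hfix z (hv.trans_le hz.1) (sub_eq_zero.1 hz').symm
  have := forall_gt_of_contracting (P := fun v => NegligibleDeviation V G β σ (σ * v)) hρc hv₀
    (fun v hv => NegligibleDeviation.of_large hβ hσ hv)
    (fun v w hv hw => hv.step hβ hσ (by rw [mul_sub, ← mul_assoc, hσσ, one_mul]; linarith))
    (v := σ * u) (by linarith [mul_sub σ u (Psi V G β p)])
  rwa [← mul_assoc, hσσ, one_mul] at this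

end Deviation

section Mean

variable {s : ℕ} {V : Fin s → ℕ} {G : ∀ i, SimpleGraph (Fin (V i))} {β : Fin s → ℝ}

theorem hasDerivAt_Psi (t : ℝ) : HasDerivAt (Psi V G β)
    (∑ i, 2 * β i * numEdges (G i) * ((numEdges (G i) - 1 : ℕ) * t ^ (numEdges (G i) - 2))) t := by
  unfold Psi
  refine HasDerivAt.fun_sum fun i _ => ?_
  have := (hasDerivAt_pow (numEdges (G i) - 1) t).const_mul (2 * β i * numEdges (G i))
  rwa [Nat.sub_sub] at this

theorem exists_gt_gt_mul_lt_one {c m : ℝ} (h : c * m < 1) :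
    ∃ K, c < K ∧ ∃ d, m < d ∧ K * d < 1 := by
  have hlim : Tendsto (fun δ : ℝ => (c + δ) * (m + δ)) (nhdsWithin 0 (Set.Ioi 0))
      (nhds (c * m)) := by
    have : Continuous fun δ : ℝ => (c + δ) * (m + δ) := by fun_prop
    simpa using (this.tendsto 0).mono_left nhdsWithin_le_nhds
  obtain ⟨δ, h1, h2⟩ := ((hlim.eventually_lt_const h).and self_mem_nhdsWithin).exists
  exact ⟨c + δ, lt_add_of_pos_right _ h2, m + δ, lt_add_of_pos_right _ h2, h1⟩

variable (hβ : ∀ i, 0 < β i)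
include hβ

theorem negligible_discDeriv_derivSum {p d : ℝ} (hsub : Subcritical V G β p)
    (hd : deriv (Psi V G β) p < d) :
    Negligible fun n e => gibbsP (Hamiltonian (n := n) V G β)
      {x | 0 < 1 * (discDeriv e (derivSum (Hamiltonian V G β)) x - d)} := by
  set D : ℝ → ℝ := fun t => ∑ i, 2 * β i * numEdges (G i) *
    ((numEdges (G i) - 1 : ℕ) * t ^ (numEdges (G i) - 2)) with hD
  have hDc : Continuous fun u => D (Phi u) := by
    have : Continuous D := by fun_prop
    exact this.comp contDiff_Phi.continuous
  have hp : Phi (Psi V G β p) = p := hsub.1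
  rw [(hasDerivAt_Psi p).deriv, ← hp] at hd
  have hev : ∀ᶠ u in nhdsWithin (Psi V G β p) (Set.Ioi (Psi V G β p)), D (Phi u) < d :=
    ((hDc.tendsto (Psi V G β p)).mono_left nhdsWithin_le_nhds).eventually_lt_const hd
  obtain ⟨u, hu, hu'⟩ := (hev.and self_mem_nhdsWithin).exists
  obtain ⟨L, hL, hinf⟩ := exists_influence_bound V G hβ
  refine (negligibleDeviation_of_subcritical hβ hsub (Or.inl rfl) (u := u)
    (by rw [one_mul]; exact sub_pos.2 hu')).negligible (Or.inl rfl) hL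
    (fun n e => hinf n e _ (Or.inr rfl)) (η := d - D (Phi u)) (sub_pos.2 hu) (N := 0)
    fun n _ e x => ?_
  have := resampleList_discDeriv_derivSum_le V G hβ (Phi_mem_Icc u) e x
  linarith

/-- In the subcritical regime the number of edges has variance of order at most `n ^ 2`. -/
theorem exists_gibbsCov_coordSum_le {p : ℝ} (hsub : Subcritical V G β p) :
    ∃ C > 0, ∃ N : ℕ, ∀ n, N ≤ n → gibbsCov (Hamiltonian (n := n) V G β) coordSum coordSum ≤
      C * Fintype.card (EdgeSet n) := by
  set u₀ := Psi V G β p with hu₀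
  have hp : Phi u₀ = p := hsub.1
  have hchain : deriv (phiFn V G β) p = deriv Phi u₀ * deriv (Psi V G β) p :=
    deriv_comp p (contDiff_Phi.differentiable one_ne_zero _) (hasDerivAt_Psi p).differentiableAt
  obtain ⟨K, hK, d, hd, hKd⟩ := exists_gt_gt_mul_lt_one (hchain ▸ hsub.2.2)
  have hK0 : 0 ≤ K := (Phi_strictMono.monotone.deriv_nonneg).trans hK.le
  have hd0 : 0 ≤ d := by
    refine le_trans ?_ hd.le
    rw [(hasDerivAt_Psi p).deriv]
    refine sum_nonneg fun i _ => ?_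
    have := (hβ i).le
    have hp0 : 0 ≤ p := hp ▸ (Phi_mem_Icc u₀).1
    positivity
  obtain ⟨ε, hε, hlip⟩ := exists_lipschitz_Phi hK
  obtain ⟨N₁, hN₁⟩ := negligibleDeviation_of_subcritical hβ hsub (Or.inl rfl)
    (u := u₀ + ε) (by linarith) 4
  obtain ⟨N₂, hN₂⟩ := negligibleDeviation_of_subcritical hβ hsub (Or.inr rfl)
    (u := u₀ - ε) (by linarith) 4
  obtain ⟨N₃, hN₃⟩ := negligible_discDeriv_derivSum hβ hsub hd 4
  refine ⟨2 / (1 - K * d), div_pos two_pos (by linarith), max 1 (max N₁ (max N₂ N₃)),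
    fun n hn => ?_⟩
  simp only [max_le_iff] at hn
  have hn0 : (0 : ℝ) < n := by exact_mod_cast hn.1
  set H : Config n → ℝ := Hamiltonian V G β with hH
  have h1 := gibbsCov_coordSum_self_le (Hamiltonian_supermodular V G hβ)
    (monotone_discDeriv_Hamiltonian V G hβ) (monotone_discDeriv_derivSum_Hamiltonian V G hβ)
    hK0 hd0 (by linarith) hlip (H := H)
  set M : ℝ := (Fintype.card (EdgeSet n) : ℝ) with hM
  set B₁ : EdgeSet n → Set (Config n) := fun e => {x | 0 < 1 * (discDeriv e H x - (u₀ + ε))}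
  set B₂ : EdgeSet n → Set (Config n) := fun e => {x | 0 < -1 * (discDeriv e H x - (u₀ - ε))}
  set B₃ : EdgeSet n → Set (Config n) := fun e => {x | 0 < 1 * (discDeriv e (derivSum H) x - d)}
  have h2 := gibbsP_le_sum H (J := EdgeSet n ⊕ (EdgeSet n ⊕ EdgeSet n))
    (A := {x | ¬ ∀ e, discDeriv e H x ∈ Set.Icc (u₀ - ε) (u₀ + ε) ∧
        discDeriv e (derivSum H) x ≤ d}) (B := Sum.elim B₁ (Sum.elim B₂ B₃)) (by
      intro x hx
      rw [Set.mem_ofPred_eq] at hx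
      push Not at hx
      obtain ⟨e, he⟩ := hx
      rw [Set.mem_iUnion]
      by_contra! hno
      have h1 : ¬ 0 < 1 * (discDeriv e H x - (u₀ + ε)) := hno (Sum.inl e)
      have h2 : ¬ 0 < -1 * (discDeriv e H x - (u₀ - ε)) := hno (Sum.inr (Sum.inl e))
      have h3 : ¬ 0 < 1 * (discDeriv e (derivSum H) x - d) := hno (Sum.inr (Sum.inr e))
      linarith [he ⟨by linarith, by linarith⟩])
  simp only [Fintype.sum_sum_type, Sum.elim_inl, Sum.elim_inr] at h2
  have hsum : ∀ B : EdgeSet n → Set (Config n), (∀ e, gibbsP H (B e) * (n : ℝ) ^ 4 ≤ 1) →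
      (∑ e, gibbsP H (B e)) * (n : ℝ) ^ 4 ≤ M := fun B hB => by
    rw [sum_mul]
    exact (sum_le_sum fun e _ => hB e).trans (by simp [hM])
  have h3 := hsum B₁ fun e => hN₁ n hn.2.1 e
  have h4 := hsum B₂ fun e => hN₂ n hn.2.2.1 e
  have h5 := hsum B₃ fun e => hN₃ n hn.2.2.2 e
  have hMn : M ≤ (n : ℝ) ^ 2 / 2 := card_edgeSet_le n
  have hM0 : 0 ≤ M := Nat.cast_nonneg _
  have hn4 : (0 : ℝ) < (n : ℝ) ^ 4 := by positivity
  have h6 : M ^ 2 * gibbsP H {x | ¬ ∀ e, discDeriv e H x ∈ Set.Icc (u₀ - ε) (u₀ + ε) ∧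
      discDeriv e (derivSum H) x ≤ d} ≤ M := by
    have h7 := mul_le_mul_of_nonneg_right h2 hn4.le
    have h8 : M ^ 2 ≤ (n : ℝ) ^ 4 / 4 := by
      calc M ^ 2 ≤ ((n : ℝ) ^ 2 / 2) ^ 2 := by gcongr
        _ = _ := by ring
    have h9 := gibbsP_nonneg H {x | ¬ ∀ e, discDeriv e H x ∈ Set.Icc (u₀ - ε) (u₀ + ε) ∧
      discDeriv e (derivSum H) x ≤ d}
    have h10 := mul_le_mul_of_nonneg_right h8 h9
    linarith
  rw [div_mul_eq_mul_div, le_div_iff₀ (by linarith)]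
  linarith

/-- In the subcritical regime distinct edges have covariance of order at most `1 / n`. -/
theorem exists_gibbsCov_le {p : ℝ} (hsub : Subcritical V G β p) :
    ∃ C > 0, ∃ N : ℕ, ∀ n, N ≤ n → ∀ e f : EdgeSet n, e ≠ f →
      gibbsCov (Hamiltonian V G β) (monomial {e}) (monomial {f}) ≤ C / n := by
  obtain ⟨C, hC, N, hN⟩ := exists_gibbsCov_coordSum_le hβ hsub
  refine ⟨6 * C, by positivity, N, fun n hn e f hef => ?_⟩
  set H : Config n → ℝ := Hamiltonian V G β with hH
  set w : EdgeSet n → EdgeSet n → ℝ := fun e f => gibbsCov H (monomial {e}) (monomial {f})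
  have hσ : ∀ σ e f, w (edgePerm σ e) (edgePerm σ f) = w e f := fun σ e f =>
    gibbsCov_monomial_equiv (Hamiltonian_comp_edgePerm V G σ) e f
  have hrow : ∀ e e', ∑ f, w e f = ∑ f, w e' f := by
    intro e e'
    obtain ⟨σ, rfl⟩ := exists_edgePerm_eq e e'
    rw [← Equiv.sum_comp (edgePerm σ) (w (edgePerm σ e))]
    exact (sum_congr rfl fun f _ => hσ σ e f).symm
  have htot : gibbsCov H coordSum coordSum = ∑ e, ∑ f, w e f := by
    have h1 : ∀ g, gibbsCov H g coordSum = ∑ f, gibbsCov H g (monomial {f}) := fun g =>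
      gibbsCov_sum_right _ _ _
    rw [h1]
    refine sum_congr rfl fun f _ => ?_
    rw [gibbsCov_comm, h1]
  refine le_div_of_edgePerm_invariant (w := w) (fun e f =>
    gibbsCov_nonneg (Hamiltonian_supermodular V G hβ) (monomial_monotone _) (monomial_monotone _))
    hσ (fun e => ?_) hef
  have h := hN n hn
  rw [htot, sum_congr rfl fun e' _ => hrow e' e, sum_const, nsmul_eq_mul, card_univ,
    mul_comm C] at h
  exact le_of_mul_le_mul_left h (Nat.cast_pos.2 (Fintype.card_pos_iff.2 ⟨e⟩))

end Mean

/-- **(Equation (646): the mean of `∂_1 H` is close to `Ψ_β` of the edge marginal).**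
With `a_n = 𝔼 X_e`, `|𝔼 ∂_e H(X) - Ψ_β(a_n)| ≤ C/n` for all sufficiently large `n`. -/
theorem mean_dHam_close_to_Psi {s : ℕ} (V : Fin s → ℕ)
    (G : ∀ i, SimpleGraph (Fin (V i))) (β : Fin s → ℝ) (hβ : ∀ i, 0 < β i)
    (p : ℝ) (hsub : Subcritical V G β p) :
    ∃ C : ℝ, 0 < C ∧ ∃ N : ℕ, ∀ n : ℕ, N ≤ n → ∀ e : EdgeSet n,
      |expect (ergmProb V G β) (dHam V G β e) -
          Psi V G β (expect (ergmProb V G β) (edgeX e))| ≤ C / (n : ℝ) := by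
  obtain ⟨C, hC, N, hN⟩ := exists_gibbsCov_le hβ hsub
  set C₁ := ∑ i, 2 * β i * numEdges (G i) * (V i : ℝ) ^ 2 with hC₁
  set C₂ := ∑ i, 2 * β i * numEdges (G i) * (numEdges (G i) : ℝ) ^ 2 with hC₂
  have hC₁0 : 0 ≤ C₁ := sum_nonneg fun i _ => by have := (hβ i).le; positivity
  have hC₂0 : 0 ≤ C₂ := sum_nonneg fun i _ => by have := (hβ i).le; positivity
  refine ⟨C₂ * C + C₁ + 1, by positivity, N, fun n hn e => ?_⟩
  set H : Config n → ℝ := Hamiltonian V G β with hH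
  set a := gibbsE H (monomial {e}) with ha
  have hX : edgeX e = monomial {e} := by
    funext x
    simp [edgeX, monomial]
  have hD : (dHam V G β e : Config n → ℝ) = discDeriv e H := rfl
  change |gibbsE H (dHam V G β e) - Psi V G β (gibbsE H (edgeX e))| ≤ _
  rw [hX, hD, ← ha]
  have hane : ∀ f, gibbsE H (monomial {f}) = a := by
    intro f
    obtain ⟨σ, rfl⟩ := exists_edgePerm_eq e f
    exact gibbsE_monomial_equiv (Hamiltonian_comp_edgePerm V G σ) e
  have hmono := abs_gibbsE_monomial_sub_pow_le (Hamiltonian_supermodular V G hβ)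
    (by positivity : 0 ≤ C / n) hane (hN n hn)
  have ha01 : a ∈ Set.Icc (0 : ℝ) 1 := gibbsE_mem_Icc H (monomial_mem_Icc {e})
  have h1 := abs_resampleList_discDeriv_sub_Psi_le V G hβ ha01 e ⊥
  have h2 : |gibbsE H (discDeriv e H) -
      resampleList a univ.toList (discDeriv e H) ⊥| ≤ C₂ * (C / n) := by
    rw [hH, Hamiltonian_eq_poly, resampleList_discDeriv_poly, ← Hamiltonian_eq_poly, ← hH]
    have h3 : gibbsE H (discDeriv e H) = ∑ j, if e ∈ copyEdges V G j then
        copyCoef V β j * gibbsE H (monomial ((copyEdges V G j).erase e)) else 0 := by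
      conv_lhs => enter [2]; rw [hH, Hamiltonian_eq_poly, discDeriv_poly]
      unfold poly
      rw [gibbsE_sum]
      refine sum_congr rfl fun j _ => ?_
      rw [gibbsE_const_mul]
      by_cases he : e ∈ copyEdges V G j <;> simp [he]
    rw [h3, ← sum_sub_distrib]
    have h4 := sum_copies_le V G hβ e (F := fun i => (numEdges (G i) : ℝ) ^ 2 * (C / n))
      fun i => by positivity
    refine (abs_sum_le_sum_abs _ _).trans (le_trans (sum_le_sum fun j _ => ?_) (h4.trans_eq ?_))
    · split_ifs with hj
      · rw [← mul_sub, abs_mul, abs_of_nonneg (copyCoef_nonneg V hβ j)]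
        refine mul_le_mul_of_nonneg_left ?_ (copyCoef_nonneg V hβ j)
        rw [← card_erase_of_mem hj, ← card_copyEdges V G j]
        refine (hmono _).trans ?_
        have := card_erase_le (s := copyEdges V G j) (a := e)
        gcongr
      · simp
    · rw [hC₂, sum_mul]
      exact sum_congr rfl fun i _ => by ring
  calc |gibbsE H (discDeriv e H) - Psi V G β a|
      ≤ |gibbsE H (discDeriv e H) - resampleList a univ.toList (discDeriv e H) ⊥| +
        |resampleList a univ.toList (discDeriv e H) ⊥ - Psi V G β a| := abs_sub_le _ _ _
    _ ≤ C₂ * (C / n) + C₁ / n := add_le_add h2 h1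
    _ = (C₂ * C + C₁) / n := by ring
    _ ≤ (C₂ * C + C₁ + 1) / n := div_le_div_of_nonneg_right (by linarith) (Nat.cast_nonneg n)

end ERGM
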